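/- Let p, q be positive integers. The number of maximal chains in NC^B(p,q) equals C(p+q, p) · p^p · q^q + Σ_{c ≥ 1} 2c · C(p+q, p-c) · p^{p-c} · q^{q+c}. -/

import Mathlib

/-!  Common setup: annular non-crossing partitions of type B, following
Goulden–Nica–Oancea, "Enumerative properties of NC^(B)(p,q)". -/

/-- The underlying set `{±1, …, ±n}`, realized inside `ℤ`. -/
def signedSet (n : ℕ) : Set ℤ := {x : ℤ | x ≠ 0 ∧ |x| ≤ (n : ℤ)}

/-- Membership in the hyperoctahedral group `B_n`, realized as the permutations of `ℤ`
that commute with negation and fix every point outside `{±1, …, ±n}`. -/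
def inB (n : ℕ) (π : Equiv.Perm ℤ) : Prop :=
  (∀ x : ℤ, π (-x) = -(π x)) ∧ ∀ x : ℤ, x ∉ signedSet n → π x = x

/-- The set of generators of `B_n`:
`(i,j)(-i,-j)`, `(i,-j)(-i,j)` for `1 ≤ i ≠ j ≤ n`, and `(i,-i)` for `1 ≤ i ≤ n`. -/
def genB (n : ℕ) : Set (Equiv.Perm ℤ) :=
  {π | (∃ i j : ℤ, 1 ≤ i ∧ i ≤ (n : ℤ) ∧ 1 ≤ j ∧ j ≤ (n : ℤ) ∧ i ≠ j ∧
          π = Equiv.swap i j * Equiv.swap (-i) (-j)) ∨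
       (∃ i j : ℤ, 1 ≤ i ∧ i ≤ (n : ℤ) ∧ 1 ≤ j ∧ j ≤ (n : ℤ) ∧ i ≠ j ∧
          π = Equiv.swap i (-j) * Equiv.swap (-i) j) ∨
       (∃ i : ℤ, 1 ≤ i ∧ i ≤ (n : ℤ) ∧ π = Equiv.swap i (-i))}

/-- The length function `ℓ_B` on `B_n`: the least `k` such that `τ` is a product of `k`
generators from `genB n` (the empty product being the identity). -/
noncomputable def lenB (n : ℕ) (τ : Equiv.Perm ℤ) : ℕ :=
  sInf {k : ℕ | ∃ l : List (Equiv.Perm ℤ),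
    l.length = k ∧ (∀ g ∈ l, g ∈ genB n) ∧ l.prod = τ}

/-- The partial order on `B_n`:  `τ ≤ σ` iff `ℓ_B(σ) = ℓ_B(τ) + ℓ_B(τ⁻¹σ)`. -/
def leB (n : ℕ) (τ σ : Equiv.Perm ℤ) : Prop :=
  lenB n σ = lenB n τ + lenB n (τ⁻¹ * σ)

/-- The permutation `γ_{p,q} = (1,…,p,-1,…,-p)(p+1,…,p+q,-(p+1),…,-(p+q))`. -/
def gammaPQ (p q : ℕ) : Equiv.Perm ℤ :=
  (((List.range p).map fun i => ((i : ℤ) + 1)) ++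
      ((List.range p).map fun i => -((i : ℤ) + 1))).formPerm *
    (((List.range q).map fun i => ((p : ℤ) + (i : ℤ) + 1)) ++
      ((List.range q).map fun i => -((p : ℤ) + (i : ℤ) + 1))).formPerm

/-- The long cycle `γ_n = (1,…,n,-1,…,-n)` of `B_n` (disc case). -/
def gammaDisc (n : ℕ) : Equiv.Perm ℤ :=
  (((List.range n).map fun i => ((i : ℤ) + 1)) ++
    ((List.range n).map fun i => -((i : ℤ) + 1))).formPerm

/-- The annular non-crossing permutations of type B: `S^B_nc(p,q) = [ε, γ_{p,q}] ⊆ B_{p+q}`. -/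
def SncB (p q : ℕ) : Set (Equiv.Perm ℤ) :=
  {τ | inB (p + q) τ ∧ leB (p + q) τ (gammaPQ p q)}

/-- The orbit of `x` under the permutation `τ`. -/
def permOrbit (τ : Equiv.Perm ℤ) (x : ℤ) : Set ℤ := {y | ∃ m : ℤ, (τ ^ m) x = y}

/-- The partition `Ω(τ)` of `{±1,…,±n}` into orbits of `τ`. -/
def orbitsOn (n : ℕ) (τ : Equiv.Perm ℤ) : Set (Set ℤ) :=
  {A | ∃ x ∈ signedSet n, A = permOrbit τ x}

/-- The negation `-A` of a set `A ⊆ ℤ`. -/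
def negSet (A : Set ℤ) : Set ℤ := {x | -x ∈ A}

/-- The partition `Ω̃(τ)`, obtained from `Ω(τ)` by merging all inversion-invariant orbits
(orbits `A` with `A = -A`) into a single block. -/
def omegaTilde (n : ℕ) (τ : Equiv.Perm ℤ) : Set (Set ℤ) :=
  {A | A ∈ orbitsOn n τ ∧ negSet A ≠ A} ∪
    {B | B = ⋃₀ {A | A ∈ orbitsOn n τ ∧ negSet A = A} ∧ B.Nonempty}

/-- The annular non-crossing partitions of type B: `NC^B(p,q) = {Ω̃(τ) : τ ∈ S^B_nc(p,q)}`. -/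
def NCB (p q : ℕ) : Set (Set (Set ℤ)) :=
  {π | ∃ τ ∈ SncB p q, π = omegaTilde (p + q) τ}

/-- The type B non-crossing partitions of the disc: `NC^B(n) = {Ω̃(τ) : τ ∈ B_n, τ ≤ γ_n}`. -/
def NCBdisc (n : ℕ) : Set (Set (Set ℤ)) :=
  {π | ∃ τ, inB n τ ∧ leB n τ (gammaDisc n) ∧ π = omegaTilde n τ}

/-- Reverse refinement order on partitions: every block of `π` is contained in a block of `ρ`. -/
def refines (π ρ : Set (Set ℤ)) : Prop := ∀ A ∈ π, ∃ B ∈ ρ, A ⊆ B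

/-- The rank of a partition of `{±1,…,±n}`:
`n` minus half the number of blocks `A` with `A ≠ -A`. -/
noncomputable def rankNCB (n : ℕ) (π : Set (Set ℤ)) : ℕ :=
  n - {A | A ∈ π ∧ negSet A ≠ A}.ncard / 2

/-- The inner point set `{±(p+1), …, ±(p+q)}`. -/
def innerSet (p q : ℕ) : Set ℤ := {x : ℤ | (p : ℤ) < |x| ∧ |x| ≤ (p : ℤ) + (q : ℤ)}

/-- The connectivity of `π ∈ NC^B(p,q)`: half the number of blocks `A` with `A ≠ -A`
meeting both `{±1,…,±p}` and `{±(p+1),…,±(p+q)}`. -/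
noncomputable def connectivity (p q : ℕ) (π : Set (Set ℤ)) : ℕ :=
  {A | A ∈ π ∧ negSet A ≠ A ∧ (A ∩ signedSet p).Nonempty ∧
    (A ∩ innerSet p q).Nonempty}.ncard / 2

/-- The number of exterior pairs of blocks `{A, -A}` (with `A ≠ -A`, `A ⊆ {±1,…,±p}`). -/
noncomputable def extPairs (p : ℕ) (π : Set (Set ℤ)) : ℕ :=
  {A | A ∈ π ∧ negSet A ≠ A ∧ A ⊆ signedSet p}.ncard / 2

/-- The number of interior pairs of blocks `{A, -A}`
(with `A ≠ -A`, `A ⊆ {±(p+1),…,±(p+q)}`). -/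
noncomputable def intPairs (p q : ℕ) (π : Set (Set ℤ)) : ℕ :=
  {A | A ∈ π ∧ negSet A ≠ A ∧ A ⊆ innerSet p q}.ncard / 2

/-- The minimum `0̂` of `NC^B(p,q)` (with `n = p+q`): the partition into singletons. -/
def botNCB (n : ℕ) : Set (Set ℤ) := {A | ∃ x ∈ signedSet n, A = {x}}

/-- The maximum `1̂` of `NC^B(p,q)` (with `n = p+q`): the partition with a single block. -/
def topNCB (n : ℕ) : Set (Set ℤ) := {signedSet n}

/-- The orbit of `x` under the subgroup generated by `{τ, γ}`. -/
def jointOrbit (τ γ : Equiv.Perm ℤ) (x : ℤ) : Set ℤ :=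
  {y | ∃ g ∈ Subgroup.closure ({τ, γ} : Set (Equiv.Perm ℤ)), g x = y}

/-- The orbits on `{±1,…,±n}` of the subgroup generated by `{τ, γ}`. -/
def jointOrbitsOn (n : ℕ) (τ γ : Equiv.Perm ℤ) : Set (Set ℤ) :=
  {Y | ∃ x ∈ signedSet n, Y = jointOrbit τ γ x}


section NumericPart
open Finset

noncomputable def ncW (k : ℕ) : ℚ := (k : ℚ) ^ (k - 1) / (k.factorial : ℚ)
noncomputable def ncU (k : ℕ) : ℚ := (k : ℚ) ^ k / (k.factorial : ℚ)
noncomputable def ncE (r : ℕ) (x : ℚ) : ℚ := x ^ r / (r.factorial : ℚ)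

theorem ncE_zero (x : ℚ) : ncE 0 x = 1 := by simp [ncE]

theorem ncE_succ (r : ℕ) (x : ℚ) : ((r : ℚ) + 1) * ncE (r + 1) x = x * ncE r x := by
  unfold ncE
  have : (r.factorial : ℚ) ≠ 0 := by positivity
  rw [Nat.factorial_succ]; push_cast; field_simp; ring

theorem nc_alt (m : ℕ) (hm : 1 ≤ m) :
    ∑ i ∈ range (m + 1), ncW (i + 1) * ncE (m - i) (-((i : ℚ) + 1)) = 0 := by
  have h1 := fwdDiff_iter_eq_sum_shift (1 : ℚ) (fun x : ℚ => x ^ m) (m + 1) 0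
  have h2 := fwdDiff_iter_pow_eq_zero_of_lt (R := ℚ) (Nat.lt_succ_self m)
  have h3 := congrFun h2 0
  rw [Nat.succ_eq_add_one, h1, Finset.sum_range_succ', Pi.zero_apply] at h3
  have hf : ((m + 1).factorial : ℚ) ≠ 0 := by positivity
  have : ((m + 1).factorial : ℚ) * ∑ i ∈ range (m + 1), ncW (i + 1) * ncE (m - i) (-((i : ℚ) + 1)) = 0 := by
    rw [← h3, Finset.mul_sum]
    have h0 : m ≠ 0 := by omega
    simp only [zero_smul, add_zero, nsmul_eq_mul, mul_one, zero_add, ne_eq, h0, not_false_eq_true, zero_pow, smul_zero, zsmul_eq_mul]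
    apply Finset.sum_congr rfl
    intro i hi
    have hi' : i ≤ m := by simpa [Nat.lt_succ_iff] using hi
    have hc := Nat.choose_mul_factorial_mul_factorial (show i + 1 ≤ m + 1 by omega)
    rw [show m + 1 - (i + 1) = m - i by omega] at hc ⊢
    have hc' : (((m+1).choose (i+1) : ℕ) : ℚ) * ((i+1).factorial : ℚ) * ((m-i).factorial : ℚ) = ((m+1).factorial : ℚ) := by exact_mod_cast hc
    unfold ncW ncE
    have e1 : ((i + 1).factorial : ℚ) ≠ 0 := by positivity
    have e2 : ((m - i).factorial : ℚ) ≠ 0 := by positivity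
    rw [← hc', neg_pow]
    push_cast
    have : ((i:ℚ)+1)^m = ((i:ℚ)+1)^i * ((i:ℚ)+1)^(m-i) := by rw [← pow_add]; congr 1; omega
    rw [this]
    field_simp
  exact (mul_eq_zero.mp this).resolve_left hf

open Polynomial in
theorem nc_abel (m : ℕ) (y : ℚ) :
    ∑ i ∈ range (m + 1), ncW (i + 1) * ncE (m - i) (y - ((i : ℚ) + 1)) = ncE m y := by
  induction m generalizing y with
  | zero => simp [ncE, ncW]
  | succ m ih =>
    let A : ℚ[X] := ∑ i ∈ range (m + 2), C (ncW (i + 1) / ((m + 1 - i).factorial : ℚ)) * (X - C ((i : ℚ) + 1)) ^ (m + 1 - i) - C (1 / ((m+1).factorial : ℚ)) * X ^ (m + 1)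
    have hev : ∀ y, A.eval y = ∑ i ∈ range (m + 2), ncW (i + 1) * ncE (m + 1 - i) (y - ((i : ℚ) + 1)) - ncE (m + 1) y := by
      intro y
      simp only [A, eval_sub, eval_finsetSum, eval_mul, eval_C, eval_pow, eval_X, ncE]
      congr 1
      · apply Finset.sum_congr rfl; intros; ring
      · ring
    have hd : derivative A = 0 := by
      apply Polynomial.funext
      intro y
      simp only [A, derivative_sub, derivative_sum, derivative_C_mul, derivative_X_pow, derivative_X_sub_C_pow, eval_sub, eval_finsetSum, eval_mul, eval_C, eval_pow, eval_X, eval_zero]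
      rw [Finset.sum_range_succ]
      simp only [Nat.sub_self, Nat.cast_zero, zero_mul, mul_zero, add_zero]
      have h := ih y
      rw [sub_eq_zero]
      have key : ∀ r : ℕ, ∀ x : ℚ, 1 / ((r+1).factorial : ℚ) * (((r + 1 : ℕ) : ℚ) * x ^ r) = ncE r x := by
        intro r x
        unfold ncE
        have : (r.factorial : ℚ) ≠ 0 := by positivity
        rw [Nat.factorial_succ]; push_cast; field_simp
      rw [Nat.add_sub_cancel, key, ← h]
      apply Finset.sum_congr rfl
      intro i hi
      have hi' : i ≤ m := by simpa [Nat.lt_succ_iff] using hi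
      rw [show m + 1 - i = (m - i) + 1 by omega, Nat.add_sub_cancel, ← key]
      ring
    have hc := derivative_eq_zero.mp hd
    rw [natDegree_eq_zero] at hc
    obtain ⟨c, hc⟩ := hc
    have h0 : A.eval 0 = 0 := by
      rw [hev]
      have := nc_alt (m + 1) (by omega)
      simp only [zero_sub]
      rw [this]; simp [ncE]
    have hy := hev y
    rw [← hc] at h0 hy
    simp only [eval_C] at h0 hy
    rw [h0] at hy
    linarith

theorem ncU_eq (k : ℕ) (hk : 1 ≤ k) : ncU k = k * ncW k := by
  obtain ⟨k, rfl⟩ : ∃ j, k = j + 1 := ⟨k - 1, by omega⟩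
  unfold ncU ncW
  rw [Nat.add_sub_cancel]; push_cast; ring

theorem ncU_eq_ncE (k : ℕ) : ncU k = ncE k k := rfl

theorem nc_N1 (k : ℕ) (hk : 1 ≤ k) :
    ∑ i ∈ range k, ncW (i + 1) * ncU (k - (i + 1)) = ncU k := by
  obtain ⟨m, rfl⟩ : ∃ j, k = j + 1 := ⟨k - 1, by omega⟩
  have h := nc_abel m (m + 1)
  have e : ncU (m+1) = ncE m (m+1) := by
    have := ncE_succ m (m+1)
    have hm : ((m:ℚ)+1) ≠ 0 := by positivity
    rw [ncU_eq_ncE]; push_cast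
    exact mul_left_cancel₀ hm this
  rw [e, ← h]
  apply Finset.sum_congr rfl
  intro i hi
  have hi' : i ≤ m := by simpa [Nat.lt_succ_iff] using hi
  rw [ncU_eq_ncE, show m + 1 - (i + 1) = m - i by omega, Nat.cast_sub hi']
  congr 2; ring

theorem nc_N2 (k : ℕ) (hk : 1 ≤ k) :
    (k : ℚ) * ∑ i ∈ range (k - 1), ncW (i + 1) * ncW (k - (i + 1)) = 2 * (((k : ℚ) - 1) * ncW k) := by
  obtain ⟨m, rfl⟩ : ∃ j, k = j + 1 := ⟨k - 1, by omega⟩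
  have h1 := nc_N1 (m+1) hk
  rw [Finset.sum_range_succ] at h1
  have hz : ncU (m + 1 - (m+1)) = 1 := by simp [ncU]
  rw [hz, ncU_eq (m+1) hk] at h1
  rw [Nat.add_sub_cancel]
  have a1 : ∑ i ∈ range m, ncW (i + 1) * ncU (m + 1 - (i + 1)) = ∑ i ∈ range m, ((m - i : ℕ) : ℚ) * (ncW (i + 1) * ncW (m + 1 - (i + 1))) := by
    apply Finset.sum_congr rfl
    intro i hi
    have : i < m := by simpa using hi
    rw [ncU_eq _ (by omega), show m + 1 - (i+1) = m - i by omega]; ring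
  have a2 : ∑ i ∈ range m, ((m - i : ℕ) : ℚ) * (ncW (i + 1) * ncW (m + 1 - (i + 1))) = ∑ i ∈ range m, ((i + 1 : ℕ) : ℚ) * (ncW (i + 1) * ncW (m + 1 - (i + 1))) := by
    rw [← Finset.sum_range_reflect]
    apply Finset.sum_congr rfl
    intro i hi
    have : i < m := by simpa using hi
    rw [show m - (m - 1 - i) = i + 1 by omega, show m - 1 - i + 1 = m - i by omega, show m + 1 - (m - i) = i + 1 by omega, show m + 1 - (i+1) = m - i by omega]
    ring
  have a3 : ((m+1 : ℕ) : ℚ) * ∑ i ∈ range m, ncW (i + 1) * ncW (m + 1 - (i + 1)) = ∑ i ∈ range m, ((m - i : ℕ) : ℚ) * (ncW (i + 1) * ncW (m + 1 - (i + 1))) + ∑ i ∈ range m, ((i + 1 : ℕ) : ℚ) * (ncW (i + 1) * ncW (m + 1 - (i + 1))) := by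
    rw [Finset.mul_sum, ← Finset.sum_add_distrib]
    apply Finset.sum_congr rfl
    intro i hi
    have : i < m := by simpa using hi
    rw [← add_mul]; congr 1; norm_cast; omega
  rw [a3, ← a2, ← a1]
  push_cast at *
  linarith

/-- h(p,q) closed form and sum form -/
noncomputable def ncH (p q : ℕ) : ℚ := ∑ c ∈ range p, ((c : ℚ) + 1) * (ncE (p - (c + 1)) p * ncE (q + (c + 1)) q)

theorem ncH_closed_aux (p q : ℕ) (k : ℕ) (hk : k ≤ p) :
    ((p : ℚ) + q) * ∑ r ∈ range k, ((p : ℚ) - r) * (ncE r p * ncE (p + q - r) q) = (k : ℚ) * ncE k p * (q * ncE (p + q - k) q) := by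
  induction k with
  | zero => simp
  | succ k ih =>
    rw [Finset.sum_range_succ, mul_add, ih (by omega)]
    have h1 := ncE_succ k p
    have h2 := ncE_succ (p + q - (k + 1)) q
    rw [show p + q - (k+1) + 1 = p + q - k by omega] at h2
    have h3 : ((p + q - (k + 1) : ℕ) : ℚ) + 1 = p + q - k := by
      rw [Nat.cast_sub (by omega)]; push_cast; ring
    rw [h3] at h2
    push_cast
    rw [h1, ← h2]; ring

theorem ncH_closed (p q : ℕ) : ((p : ℚ) + q) * ncH p q = p * q * (ncU p * ncU q) := by
  have h := ncH_closed_aux p q p le_rfl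
  rw [ncU_eq_ncE, ncU_eq_ncE]
  rw [show p + q - p = q by omega] at h
  have : ncH p q = ∑ r ∈ range p, ((p : ℚ) - r) * (ncE r p * ncE (p + q - r) q) := by
    unfold ncH
    rw [← Finset.sum_range_reflect]
    apply Finset.sum_congr rfl
    intro i hi
    have : i < p := by simpa using hi
    rw [show p - (p - 1 - i + 1) = i by omega, show q + (p - 1 - i + 1) = p + q - i by omega]
    congr 1
    rw [Nat.cast_sub (by omega), Nat.cast_sub (by omega)]; push_cast; ring
  rw [this, h]; ring

theorem nc_E_add (N : ℕ) (x y : ℚ) : ∑ r ∈ range (N + 1), ncE r x * ncE (N - r) y = ncE N (x + y) := by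
  unfold ncE
  rw [add_pow, Finset.sum_div]
  apply Finset.sum_congr rfl
  intro r hr
  have hr' : r ≤ N := by simpa [Nat.lt_succ_iff] using hr
  have hc := Nat.choose_mul_factorial_mul_factorial hr'
  have hc' : ((N.choose r : ℕ) : ℚ) * (r.factorial : ℚ) * ((N-r).factorial : ℚ) = (N.factorial : ℚ) := by exact_mod_cast hc
  have e1 : (r.factorial : ℚ) ≠ 0 := by positivity
  have e2 : ((N - r).factorial : ℚ) ≠ 0 := by positivity
  have e3 : (N.factorial : ℚ) ≠ 0 := by positivity
  field_simp
  rw [← hc']; ring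

theorem nc_E_add_mul (N : ℕ) (x y : ℚ) : ∑ r ∈ range (N + 1), (r : ℚ) * (ncE r x * ncE (N - r) y) = if N = 0 then 0 else x * ncE (N - 1) (x + y) := by
  rw [Finset.sum_range_succ']
  cases N with
  | zero => simp
  | succ N =>
    simp only [Nat.cast_zero, zero_mul, add_zero, Nat.add_eq_zero_iff, one_ne_zero, and_false, if_false, Nat.add_sub_cancel]
    rw [← nc_E_add, Finset.mul_sum]
    apply Finset.sum_congr rfl
    intro r _
    rw [show N + 1 - (r + 1) = N - r by omega, ← mul_assoc]
    push_cast
    rw [ncE_succ]; ring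

/-- vanishing of the extra terms -/
theorem nc_extra (N : ℕ) (p y : ℚ) (h : p + y = N) : ∑ r ∈ range (N + 1), (p - r) * (ncE r p * ncE (N - r) y) = if N = 0 then p else 0 := by
  simp only [sub_mul, Finset.sum_sub_distrib]
  rw [← Finset.mul_sum, nc_E_add, nc_E_add_mul, h]
  cases N with
  | zero => simp [ncE]
  | succ N =>
    have := ncE_succ N ((N+1 : ℕ) : ℚ)
    simp only [Nat.add_eq_zero_iff, one_ne_zero, and_false, if_false, Nat.add_sub_cancel]
    have hm : ((N:ℚ)+1) ≠ 0 := by positivity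
    push_cast at *
    rw [mul_left_cancel₀ hm this]; ring

theorem nc_N3a (p q : ℕ) :
    (p : ℚ) * ∑ i ∈ range p, ncW (i + 1) * ncH (p - (i + 1)) q =
      ∑ c ∈ range p, ((p : ℚ) - (c + 1)) * (((c : ℚ) + 1) * (ncE (p - (c + 1)) p * ncE (q + (c + 1)) q)) := by
  unfold ncH
  simp only [Finset.mul_sum]
  rw [Finset.sum_comm' (t' := range p) (s' := fun c => range (p - (c + 1))) (by intro x y; simp only [mem_range]; omega)]
  apply Finset.sum_congr rfl
  intro c hc
  have hc' : c < p := by simpa using hc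
  rcases Nat.eq_zero_or_pos (p - (c + 1)) with h0 | h0
  · have : p = c + 1 := by omega
    rw [h0]; subst this; simp
  · obtain ⟨M, hM⟩ : ∃ M, p - (c + 1) = M + 1 := ⟨p - (c + 1) - 1, by omega⟩
    rw [hM]
    have hab := nc_abel M p
    have hpc : (p : ℚ) - (c + 1) = M + 1 := by
      have : p = M + 1 + (c + 1) := by omega
      rw [this]; push_cast; ring
    rw [hpc, show ((M:ℚ)+1) * (((c:ℚ)+1) * (ncE (M+1) p * ncE (q + (c+1)) q)) = ((c:ℚ)+1) * ncE (q + (c+1)) q * (((M:ℚ)+1) * ncE (M+1) p) by ring, ncE_succ, ← hab, Finset.mul_sum, Finset.mul_sum]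
    apply Finset.sum_congr rfl
    intro i hi
    have hi' : i < M + 1 := by simpa using hi
    rw [show p - (i + 1) - (c + 1) = M - i by omega, Nat.cast_sub (show i + 1 ≤ p by omega)]
    push_cast; ring

theorem nc_N3b (p q : ℕ) (hp : 1 ≤ p) :
    (q : ℚ) * ∑ i ∈ range q, ncW (i + 1) * ncH p (q - (i + 1)) + p * q * ncW (p + q) =
      ∑ c ∈ range p, ((q : ℚ) + (c + 1)) * (((c : ℚ) + 1) * (ncE (p - (c + 1)) p * ncE (q + (c + 1)) q)) := by
  have hsplit : ∀ c : ℕ, ∑ i ∈ range q, ncW (i + 1) * ncE (q - (i + 1) + (c + 1)) ((q - (i+1) : ℕ) : ℚ) = ncE (q + c) q - ∑ s ∈ range (c + 1), ncW (q + s + 1) * ncE (c - s) (-((s : ℚ) + 1)) := by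
    intro c
    have hab := nc_abel (q + c) q
    rw [add_assoc, Finset.sum_range_add] at hab
    rw [← hab, eq_sub_iff_add_eq]
    congr 1
    · apply Finset.sum_congr rfl
      intro i hi
      have hi' : i < q := by simpa using hi
      rw [show q - (i + 1) + (c + 1) = q + c - i by omega, Nat.cast_sub (show i + 1 ≤ q by omega)]
      push_cast; ring
    · apply Finset.sum_congr rfl
      intro s hs
      rw [show q + c - (q + s) = c - s by omega]
      push_cast; congr 2; ring
  have hex : ∑ c ∈ range p, (((c : ℚ) + 1) * ncE (p - (c + 1)) p) * ∑ s ∈ range (c + 1), ncW (q + s + 1) * ncE (c - s) (-((s : ℚ) + 1)) = p * ncW (p + q) := by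
    simp only [Finset.mul_sum]
    rw [Finset.sum_comm' (t' := range p) (s' := fun s => Finset.Ico s p) (by intro x y; simp only [mem_range, mem_Ico]; omega)]
    have : ∀ s ∈ range p, ∑ c ∈ Finset.Ico s p, (((c : ℚ) + 1) * ncE (p - (c + 1)) p) * (ncW (q + s + 1) * ncE (c - s) (-((s : ℚ) + 1))) = ncW (q + s + 1) * if p - 1 - s = 0 then (p : ℚ) else 0 := by
      intro s hs
      have hs' : s < p := by simpa using hs
      rw [← nc_extra (p - 1 - s) p (-((s:ℚ)+1)) (by rw [Nat.cast_sub (by omega), Nat.cast_sub (by omega)]; push_cast; ring)]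
      rw [Finset.sum_Ico_eq_sum_range, Finset.mul_sum, show p - 1 - s + 1 = p - s by omega, ← Finset.sum_range_reflect]
      apply Finset.sum_congr rfl
      intro r hr
      have hr' : r < p - s := by simpa using hr
      rw [show s + (p - s - 1 - r) - s = p - 1 - s - r by omega, show p - (s + (p - s - 1 - r) + 1) = r by omega]
      have : ((s + (p - s - 1 - r) : ℕ) : ℚ) + 1 = p - r := by
        rw [show s + (p - s - 1 - r) = p - (r + 1) by omega, Nat.cast_sub (by omega)]; push_cast; ring
      rw [this]; ring
    rw [Finset.sum_congr rfl this, Finset.sum_eq_single (p - 1)]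
    · rw [show q + (p - 1) + 1 = p + q by omega]; simp; ring
    · intro b hb hb'
      have : b < p := by simpa using hb
      rw [if_neg (by omega), mul_zero]
    · intro h; exact absurd (mem_range.mpr (by omega)) h
  have h1 : ∑ i ∈ range q, ncW (i + 1) * ncH p (q - (i + 1)) = ∑ c ∈ range p, (((c : ℚ) + 1) * ncE (p - (c + 1)) p) * ∑ i ∈ range q, ncW (i + 1) * ncE (q - (i + 1) + (c + 1)) ((q - (i+1) : ℕ) : ℚ) := by
    unfold ncH
    simp only [Finset.mul_sum]
    rw [Finset.sum_comm]
    apply Finset.sum_congr rfl; intro c _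
    apply Finset.sum_congr rfl; intro i _
    ring
  rw [h1]
  simp only [hsplit, mul_sub, Finset.sum_sub_distrib]
  rw [hex, show (q:ℚ) * (p * ncW (p+q)) = p * q * ncW (p+q) by ring, sub_add_cancel, Finset.mul_sum]
  apply Finset.sum_congr rfl; intro c _
  have := ncE_succ (q + c) q
  push_cast at this
  rw [show (q:ℚ) + (c+1) = q + c + 1 by ring, show q + (c + 1) = q + c + 1 by ring]
  linear_combination (-((c:ℚ)+1) * ncE (p - (c+1)) p) * this

noncomputable def ncV (p q : ℕ) : ℚ := ncU p * ncU q * (1 + 2 * (p * q) / (p + q))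

theorem ncV_eq (p q : ℕ) : ncV p q = ncU p * ncU q + 2 * ncH p q := by
  unfold ncV
  have h := ncH_closed p q
  rcases Nat.eq_zero_or_pos p with rfl | hp
  · simp [ncH]
  have : (p : ℚ) + q ≠ 0 := by positivity
  field_simp
  linear_combination (-2) * h

theorem ncV_comm (p q : ℕ) : ncV p q = ncV q p := by unfold ncV; rw [add_comm (p:ℚ)]; ring

theorem ncV_zero (q : ℕ) : ncV 0 q = ncU q := by simp [ncV, ncU]

theorem nc_N3 (p q : ℕ) (hp : 1 ≤ p) (hq : 1 ≤ q) :
    (p : ℚ) * ∑ i ∈ range p, ncW (i + 1) * ncV (p - (i + 1)) q +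
    (q : ℚ) * ∑ i ∈ range q, ncW (i + 1) * ncV (q - (i + 1)) p + 2 * (p * q * ncW (p + q)) = (p + q) * ncV p q := by
  have e1 : ∑ i ∈ range p, ncW (i + 1) * ncV (p - (i + 1)) q = ncU p * ncU q + 2 * ∑ i ∈ range p, ncW (i + 1) * ncH (p - (i + 1)) q := by
    rw [← nc_N1 p hp, Finset.sum_mul, Finset.mul_sum, ← Finset.sum_add_distrib]
    apply Finset.sum_congr rfl; intro i _; rw [ncV_eq]; ring
  have e2 : ∑ i ∈ range q, ncW (i + 1) * ncV (q - (i + 1)) p = ncU p * ncU q + 2 * ∑ i ∈ range q, ncW (i + 1) * ncH p (q - (i + 1)) := by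
    rw [← nc_N1 q hq, Finset.mul_sum, Finset.mul_sum, ← Finset.sum_add_distrib]
    apply Finset.sum_congr rfl; intro i _; rw [ncV_comm, ncV_eq]; ring
  have e3 : ((p:ℚ)+q) * ncH p q = ∑ c ∈ range p, ((p : ℚ) - (c + 1)) * (((c : ℚ) + 1) * (ncE (p - (c + 1)) p * ncE (q + (c + 1)) q)) + ∑ c ∈ range p, ((q : ℚ) + (c + 1)) * (((c : ℚ) + 1) * (ncE (p - (c + 1)) p * ncE (q + (c + 1)) q)) := by
    unfold ncH
    rw [Finset.mul_sum, ← Finset.sum_add_distrib]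
    apply Finset.sum_congr rfl; intro i _; ring
  rw [← nc_N3a, ← nc_N3b p q hp] at e3
  rw [e1, e2, ncV_eq]
  linear_combination (-2) * e3

theorem nc_final (p q : ℕ) : ((p + q).factorial : ℚ) * ncV p q = ((Nat.choose (p + q) p * p ^ p * q ^ q +
        ∑ c ∈ Finset.Icc 1 p,
          2 * c * Nat.choose (p + q) (p - c) * p ^ (p - c) * q ^ (q + c) : ℕ) : ℚ) := by
  rw [ncV_eq, mul_add]
  push_cast
  have key : ∀ a b : ℕ, ∀ x y : ℚ, a + b = p + q → ((p+q).factorial : ℚ) * (ncE a x * ncE b y) = ((p+q).choose a : ℚ) * x ^ a * y ^ b := by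
    intro a b x y h
    have hc := Nat.choose_mul_factorial_mul_factorial (show a ≤ a + b by omega)
    rw [show a + b - a = b by omega, h] at hc
    have hc' : (((p+q).choose a : ℕ) : ℚ) * (a.factorial : ℚ) * (b.factorial : ℚ) = ((p+q).factorial : ℚ) := by exact_mod_cast hc
    unfold ncE
    have e1 : (a.factorial : ℚ) ≠ 0 := by positivity
    have e2 : (b.factorial : ℚ) ≠ 0 := by positivity
    rw [← hc']; field_simp
  congr 1
  · rw [ncU_eq_ncE, ncU_eq_ncE, key _ _ _ _ rfl]
  · unfold ncH
    rw [Finset.mul_sum, Finset.mul_sum, show Finset.Icc 1 p = Finset.Ico 1 (p+1) from rfl, Finset.sum_Ico_eq_sum_range, Nat.add_sub_cancel]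
    apply Finset.sum_congr rfl
    intro c hc
    have hc' : c < p := by simpa using hc
    have := key (p - (c+1)) (q + (c+1)) p q (by omega)
    rw [add_comm 1 c]
    push_cast
    linear_combination (2 * ((c:ℚ)+1)) * this

end NumericPart


section LinPart

/-! ### The group -/

theorem nc_mem_X {n : ℕ} {z : ℤ} : z ∈ signedSet n ↔ 1 ≤ z.natAbs ∧ z.natAbs ≤ n := by
  unfold signedSet
  simp only [Set.mem_ofPred_eq, Int.abs_eq_natAbs]
  omega

theorem nc_neg_mem_X {n : ℕ} {z : ℤ} : -z ∈ signedSet n ↔ z ∈ signedSet n := by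
  simp [nc_mem_X]

theorem inB_one (n : ℕ) : inB n 1 := ⟨fun _ => rfl, fun _ _ => rfl⟩

theorem inB.mem_iff {n : ℕ} {τ : Equiv.Perm ℤ} (h : inB n τ) (z : ℤ) : τ z ∈ signedSet n ↔ z ∈ signedSet n := by
  constructor
  · intro hz
    by_contra hc
    rw [h.2 z hc] at hz
    exact hc hz
  · intro hz
    by_contra hc
    have := h.2 _ hc
    have := τ.injective this
    rw [this] at hc
    exact hc hz

theorem inB.mul {n : ℕ} {τ σ : Equiv.Perm ℤ} (h : inB n τ) (h' : inB n σ) : inB n (τ * σ) := by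
  refine ⟨fun x => ?_, fun x hx => ?_⟩
  · simp [Equiv.Perm.mul_apply, h'.1, h.1]
  · simp [Equiv.Perm.mul_apply, h'.2 x hx, h.2 x hx]

theorem inB.inv {n : ℕ} {τ : Equiv.Perm ℤ} (h : inB n τ) : inB n τ⁻¹ := by
  refine ⟨fun x => ?_, fun x hx => ?_⟩
  · rw [Equiv.Perm.inv_eq_iff_eq, h.1]; simp
  · rw [Equiv.Perm.inv_eq_iff_eq, h.2 x hx]

theorem inB.pow {n : ℕ} {τ : Equiv.Perm ℤ} (h : inB n τ) (k : ℕ) : inB n (τ ^ k) := by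
  induction k with
  | zero => exact inB_one n
  | succ k ih => rw [pow_succ]; exact ih.mul h

/-! ### Reflections -/

def ncR (x y : ℤ) : Equiv.Perm ℤ :=
  if y = -x then Equiv.swap x y else Equiv.swap x y * Equiv.swap (-x) (-y)

theorem ncR_apply {x y : ℤ} (hx : x ≠ 0) (hy : y ≠ 0) (hxy : x ≠ y) (z : ℤ) :
    ncR x y z = if z = x then y else if z = y then x else if z = -x then -y else
      if z = -y then -x else z := by
  unfold ncR
  split_ifs with h1 <;> simp only [Equiv.Perm.mul_apply, Equiv.swap_apply_def] <;> split_ifs <;> omega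

theorem ncR_left {x y : ℤ} (hx : x ≠ 0) (hy : y ≠ 0) (hxy : x ≠ y) : ncR x y x = y := by
  simp [ncR_apply hx hy hxy]

theorem ncR_right {x y : ℤ} (hx : x ≠ 0) (hy : y ≠ 0) (hxy : x ≠ y) : ncR x y y = x := by
  rw [ncR_apply hx hy hxy]; split_ifs <;> omega

theorem ncR_odd {x y : ℤ} (hx : x ≠ 0) (hy : y ≠ 0) (hxy : x ≠ y) (z : ℤ) : ncR x y (-z) = -ncR x y z := by
  rw [ncR_apply hx hy hxy, ncR_apply hx hy hxy]; split_ifs <;> omega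

theorem ncR_other {x y z : ℤ} (hx : x ≠ 0) (hy : y ≠ 0) (hxy : x ≠ y) (h1 : z.natAbs ≠ x.natAbs) (h2 : z.natAbs ≠ y.natAbs) : ncR x y z = z := by
  rw [ncR_apply hx hy hxy]; split_ifs <;> omega

theorem ncR_comm (x y : ℤ) (hx : x ≠ 0) (hy : y ≠ 0) (hxy : x ≠ y) : ncR x y = ncR y x := by
  ext z
  rw [ncR_apply hx hy hxy, ncR_apply hy hx hxy.symm]; split_ifs <;> omega

theorem ncR_neg (x y : ℤ) (hx : x ≠ 0) (hy : y ≠ 0) (hxy : x ≠ y) : ncR (-x) (-y) = ncR x y := by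
  ext z
  rw [ncR_apply hx hy hxy, ncR_apply (by omega) (by omega) (by omega)]; split_ifs <;> omega

theorem ncR_mul_self {x y : ℤ} (hx : x ≠ 0) (hy : y ≠ 0) (hxy : x ≠ y) : ncR x y * ncR x y = 1 := by
  ext z
  rw [Equiv.Perm.mul_apply, ncR_apply hx hy hxy, ncR_apply hx hy hxy, Equiv.Perm.one_apply]; split_ifs <;> omega

theorem ncR_inB {n : ℕ} {x y : ℤ} (hx : x ∈ signedSet n) (hy : y ∈ signedSet n) (hxy : x ≠ y) : inB n (ncR x y) := by
  rw [nc_mem_X] at hx hy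
  have hx0 : x ≠ 0 := by omega
  have hy0 : y ≠ 0 := by omega
  refine ⟨ncR_odd hx0 hy0 hxy, fun z hz => ?_⟩
  rw [nc_mem_X] at hz
  apply ncR_other hx0 hy0 hxy <;> omega

theorem nc_ne_zero {n : ℕ} {x : ℤ} (hx : x ∈ signedSet n) : x ≠ 0 := hx.1

theorem genB_iff {n : ℕ} {t : Equiv.Perm ℤ} : t ∈ genB n ↔ ∃ x y : ℤ, x ∈ signedSet n ∧ y ∈ signedSet n ∧ x ≠ y ∧ t = ncR x y := by
  unfold genB
  simp only [Set.mem_ofPred_eq, nc_mem_X]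
  constructor
  · rintro (⟨i, j, h1, h2, h3, h4, h5, rfl⟩ | ⟨i, j, h1, h2, h3, h4, h5, rfl⟩ | ⟨i, h1, h2, rfl⟩)
    · refine ⟨i, j, by omega, by omega, h5, ?_⟩
      rw [ncR, if_neg (by omega)]
    · refine ⟨i, -j, by omega, by omega, by omega, ?_⟩
      rw [ncR, if_neg (by omega), neg_neg]
    · refine ⟨i, -i, by omega, by omega, by omega, ?_⟩
      rw [ncR, if_pos rfl]
  · have key : ∀ x y : ℤ, 1 ≤ x → x ≤ n → (1 ≤ y.natAbs ∧ y.natAbs ≤ n) → x ≠ y →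
      ((∃ i j : ℤ, 1 ≤ i ∧ i ≤ (n : ℤ) ∧ 1 ≤ j ∧ j ≤ (n : ℤ) ∧ i ≠ j ∧
          ncR x y = Equiv.swap i j * Equiv.swap (-i) (-j)) ∨
       (∃ i j : ℤ, 1 ≤ i ∧ i ≤ (n : ℤ) ∧ 1 ≤ j ∧ j ≤ (n : ℤ) ∧ i ≠ j ∧
          ncR x y = Equiv.swap i (-j) * Equiv.swap (-i) j) ∨
       (∃ i : ℤ, 1 ≤ i ∧ i ≤ (n : ℤ) ∧ ncR x y = Equiv.swap i (-i))) := by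
      intro x y h1 h2 h3 h4
      by_cases h : y = -x
      · right; right
        refine ⟨x, h1, h2, ?_⟩
        rw [ncR, if_pos h, h]
      · rcases lt_or_ge y 0 with hy | hy
        · right; left
          refine ⟨x, -y, h1, h2, by omega, by omega, by omega, ?_⟩
          rw [ncR, if_neg h, neg_neg]
        · left
          refine ⟨x, y, h1, h2, by omega, by omega, by omega, ?_⟩
          rw [ncR, if_neg h]
    rintro ⟨x, y, hx, hy, hxy, rfl⟩
    rcases lt_or_ge x 0 with h | h
    · rw [← ncR_neg x y (by omega) (by omega) hxy]
      exact key (-x) (-y) (by omega) (by omega) (by omega) (by omega)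
    · exact key x y (by omega) (by omega) hy hxy

theorem genB_inB {n : ℕ} {t : Equiv.Perm ℤ} (h : t ∈ genB n) : inB n t := by
  obtain ⟨x, y, hx, hy, hxy, rfl⟩ := genB_iff.mp h
  exact ncR_inB hx hy hxy

theorem inB_list {n : ℕ} (l : List (Equiv.Perm ℤ)) (h : ∀ g ∈ l, g ∈ genB n) : inB n l.prod := by
  induction l with
  | nil => exact inB_one n
  | cons a l ih =>
    rw [List.prod_cons]
    exact (genB_inB (h a (by simp))).mul (ih fun g hg => h g (by simp [hg]))

/-! ### Sums over the signed set -/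

noncomputable def ncXf (n : ℕ) : Finset ℤ := (Finset.Icc (-(n : ℤ)) n).erase 0

theorem mem_ncXf {n : ℕ} {z : ℤ} : z ∈ ncXf n ↔ z ∈ signedSet n := by
  rw [nc_mem_X]; simp only [ncXf, Finset.mem_erase, Finset.mem_Icc]; omega

theorem nc_sumX {M : Type*} [AddCommMonoid M] (n : ℕ) (G : ℤ → M) :
    ∑ z ∈ ncXf n, G z = ∑ m ∈ Finset.Icc 1 n, (G (m : ℤ) + G (-(m : ℤ))) := by
  induction n with
  | zero => rfl
  | succ n ih =>
    rw [Finset.sum_Icc_succ_top (by omega), ← ih]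
    have : ncXf (n + 1) = insert ((n + 1 : ℕ) : ℤ) (insert (-((n + 1 : ℕ) : ℤ)) (ncXf n)) := by
      ext z
      simp only [Finset.mem_insert, mem_ncXf, nc_mem_X]; omega
    rw [this, Finset.sum_insert, Finset.sum_insert]
    · rw [← add_assoc, add_comm]
    · simp only [mem_ncXf, nc_mem_X]; omega
    · simp only [Finset.mem_insert, mem_ncXf, nc_mem_X]; omega

/-! ### The linear action -/

abbrev ncSp (n : ℕ) := EuclideanSpace ℝ (Fin n)

noncomputable def ncExt (n : ℕ) (v : ncSp n) (z : ℤ) : ℝ :=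
  if h : 1 ≤ z.natAbs ∧ z.natAbs ≤ n then (z.sign : ℝ) * v ⟨z.natAbs - 1, by omega⟩ else 0

theorem ncExt_neg (n : ℕ) (v : ncSp n) (z : ℤ) : ncExt n v (-z) = - ncExt n v z := by
  unfold ncExt
  simp only [Int.natAbs_neg, Int.sign_neg]
  split_ifs <;> simp

theorem ncExt_add (n : ℕ) (v w : ncSp n) (z : ℤ) : ncExt n (v + w) z = ncExt n v z + ncExt n w z := by
  unfold ncExt
  split_ifs <;> simp [mul_add]

theorem ncExt_smul (n : ℕ) (c : ℝ) (v : ncSp n) (z : ℤ) : ncExt n (c • v) z = c * ncExt n v z := by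
  unfold ncExt
  split_ifs <;> simp [mul_left_comm]

theorem ncExt_zero (n : ℕ) (z : ℤ) : ncExt n 0 z = 0 := by
  unfold ncExt
  split_ifs <;> simp

theorem ncExt_out {n : ℕ} (v : ncSp n) {z : ℤ} (hz : z ∉ signedSet n) : ncExt n v z = 0 := by
  rw [nc_mem_X] at hz
  rw [ncExt, dif_neg hz]

theorem ncExt_coord {n : ℕ} (v : ncSp n) (i : Fin n) : ncExt n v ((i : ℤ) + 1) = v i := by
  have h : ((i : ℤ) + 1).natAbs = i + 1 := by omega
  have hs : ((i : ℤ) + 1).sign = 1 := Int.sign_eq_one_of_pos (by omega)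
  rw [ncExt, dif_pos (by omega), hs]
  simp only [Int.cast_one, one_mul]
  have e : (⟨((i : ℤ) + 1).natAbs - 1, by omega⟩ : Fin n) = i := Fin.ext (by simp only; omega)
  rw [e]

theorem ncExt_inj {n : ℕ} {v w : ncSp n} (h : ∀ z, ncExt n v z = ncExt n w z) : v = w := by
  ext i
  rw [← ncExt_coord, ← ncExt_coord, h]

noncomputable def ncRes (n : ℕ) (u : ℤ → ℝ) : ncSp n := WithLp.toLp 2 fun i : Fin n => u ((i : ℤ) + 1)

theorem ncExt_ncRes {n : ℕ} {u : ℤ → ℝ} (hodd : ∀ z, u (-z) = - u z) (hout : ∀ z, z ∉ signedSet n → u z = 0) (z : ℤ) :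
    ncExt n (ncRes n u) z = u z := by
  have hpos : ∀ z : ℤ, 0 < z → ncExt n (ncRes n u) z = u z := by
    intro z hz
    by_cases h : z ∈ signedSet n
    · have h' := nc_mem_X.mp h
      have e : z = (((⟨z.natAbs - 1, by omega⟩ : Fin n) : ℕ) : ℤ) + 1 := by simp only; omega
      rw [e, ncExt_coord]; rfl
    · rw [ncExt_out _ h, hout _ h]
  rcases lt_trichotomy z 0 with h | h | h
  · have := hpos (-z) (by omega)
    rw [ncExt_neg, hodd] at this
    linarith
  · subst h
    rw [ncExt_out _ (by simp [signedSet]), hout _ (by simp [signedSet])]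
  · exact hpos z h

noncomputable def ncAct (n : ℕ) (τ : Equiv.Perm ℤ) : ncSp n →ₗ[ℝ] ncSp n where
  toFun v := ncRes n fun z => ncExt n v (τ z)
  map_add' v w := by ext i; simp [ncRes, ncExt_add]
  map_smul' c v := by ext i; simp [ncRes, ncExt_smul]

theorem ncExt_ncAct {n : ℕ} {τ : Equiv.Perm ℤ} (h : inB n τ) (v : ncSp n) (z : ℤ) :
    ncExt n (ncAct n τ v) z = ncExt n v (τ z) := by
  apply ncExt_ncRes (u := fun z => ncExt n v (τ z))
  · intro z; simp [h.1, ncExt_neg]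
  · intro z hz; rw [h.2 z hz]; exact ncExt_out _ hz

theorem nc_inner {n : ℕ} (v w : ncSp n) : 2 * inner ℝ v w = ∑ z ∈ ncXf n, ncExt n v z * ncExt n w z := by
  rw [nc_sumX]
  simp only [ncExt_neg, neg_mul_neg, ← two_mul]
  rw [← Finset.mul_sum, PiLp.inner_apply]
  congr 1
  rw [show Finset.Icc 1 n = Finset.Ico 1 (n+1) from rfl, Finset.sum_Ico_eq_sum_range, Nat.add_sub_cancel, Finset.sum_range]
  apply Finset.sum_congr rfl
  intro i _
  have := ncExt_coord v i
  have := ncExt_coord w i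
  push_cast
  rw [add_comm (1:ℤ)]
  simp [*, mul_comm]

theorem ncAct_inner {n : ℕ} {τ : Equiv.Perm ℤ} (h : inB n τ) (v w : ncSp n) :
    inner ℝ (ncAct n τ v) (ncAct n τ w) = inner ℝ v w := by
  have h1 := nc_inner v w
  have h2 := nc_inner (ncAct n τ v) (ncAct n τ w)
  simp only [ncExt_ncAct h] at h2
  have : ∑ z ∈ ncXf n, ncExt n v (τ z) * ncExt n w (τ z) = ∑ z ∈ ncXf n, ncExt n v z * ncExt n w z := by
    apply Finset.sum_equiv τ
    · intro z; rw [mem_ncXf, mem_ncXf, h.mem_iff]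
    · intros; rfl
  rw [this] at h2
  linarith

/-! ### Fixed spaces -/

noncomputable def ncFx (n : ℕ) (τ : Equiv.Perm ℤ) : Submodule ℝ (ncSp n) where
  carrier := {v | ∀ z, ncExt n v (τ z) = ncExt n v z}
  add_mem' := by intro a b ha hb z; simp [ncExt_add, ha z, hb z]
  zero_mem' := by intro z; simp [ncExt_zero]
  smul_mem' := by intro c a ha z; simp [ncExt_smul, ha z]

theorem mem_ncFx {n : ℕ} {τ : Equiv.Perm ℤ} {v : ncSp n} : v ∈ ncFx n τ ↔ ∀ z, ncExt n v (τ z) = ncExt n v z := Iff.rfl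

theorem ncFx_inv (n : ℕ) (τ : Equiv.Perm ℤ) : ncFx n τ⁻¹ = ncFx n τ := by
  ext v
  simp only [mem_ncFx]
  constructor
  · intro h z
    have := h (τ z)
    simp at this; exact this.symm
  · intro h z
    have := h (τ⁻¹ z)
    simp at this; exact this.symm

noncomputable def ncCd (n : ℕ) (τ : Equiv.Perm ℤ) : ℕ := n - Module.finrank ℝ (ncFx n τ)

theorem ncCd_add (n : ℕ) (τ : Equiv.Perm ℤ) : ncCd n τ + Module.finrank ℝ (ncFx n τ) = n := by
  have h := Submodule.finrank_le (ncFx n τ)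
  rw [finrank_euclideanSpace_fin] at h
  unfold ncCd; omega

theorem ncFx_mul (n : ℕ) (τ σ : Equiv.Perm ℤ) : ncFx n τ ⊓ ncFx n σ ≤ ncFx n (τ * σ) := by
  intro v hv z
  rw [Equiv.Perm.mul_apply, hv.1, hv.2]

theorem nc_inf_finrank {n : ℕ} (A B : Submodule ℝ (ncSp n)) : Module.finrank ℝ A + Module.finrank ℝ B ≤ n + Module.finrank ℝ (A ⊓ B : Submodule ℝ (ncSp n)) := by
  have h := Submodule.finrank_sup_add_finrank_inf_eq A B
  have h2 := Submodule.finrank_le (A ⊔ B)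
  rw [finrank_euclideanSpace_fin] at h2
  omega

theorem ncCd_mul (n : ℕ) (τ σ : Equiv.Perm ℤ) : ncCd n (τ * σ) ≤ ncCd n τ + ncCd n σ := by
  have h1 := Submodule.finrank_mono (ncFx_mul n τ σ)
  have h2 := nc_inf_finrank (ncFx n τ) (ncFx n σ)
  have := ncCd_add n τ
  have := ncCd_add n σ
  have := ncCd_add n (τ * σ)
  omega

theorem ncFx_of_le (n : ℕ) (τ σ : Equiv.Perm ℤ) (h : ncCd n τ + ncCd n σ ≤ ncCd n (τ * σ)) :
    ncFx n (τ * σ) ≤ ncFx n τ ⊓ ncFx n σ := by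
  have h2 := nc_inf_finrank (ncFx n τ) (ncFx n σ)
  have := ncCd_add n τ
  have := ncCd_add n σ
  have := ncCd_add n (τ * σ)
  exact (Submodule.eq_of_le_of_finrank_le (ncFx_mul n τ σ) (by omega)).ge

/-- fixed by a reflection -/
theorem ncFx_ncR {n : ℕ} {x y : ℤ} (hx : x ≠ 0) (hy : y ≠ 0) (hxy : x ≠ y) (v : ncSp n) :
    v ∈ ncFx n (ncR x y) ↔ ncExt n v x = ncExt n v y := by
  rw [mem_ncFx]
  constructor
  · intro h
    have := h x
    rw [ncR_left hx hy hxy] at this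
    exact this.symm
  · intro h z
    rw [ncR_apply hx hy hxy]
    split_ifs with h1 h2 h3 h4
    · rw [h1, h]
    · rw [h2, h]
    · rw [h3, ncExt_neg, ncExt_neg, h]
    · rw [h4, ncExt_neg, ncExt_neg, h]
    · rfl

noncomputable def ncFun (n : ℕ) (x y : ℤ) : ncSp n →ₗ[ℝ] ℝ where
  toFun v := ncExt n v x - ncExt n v y
  map_add' v w := by simp [ncExt_add]; ring
  map_smul' c v := by simp [ncExt_smul]; ring

theorem ncCd_ncR {n : ℕ} {x y : ℤ} (hx : x ≠ 0) (hy : y ≠ 0) (hxy : x ≠ y) : ncCd n (ncR x y) ≤ 1 := by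
  have hk : LinearMap.ker (ncFun n x y) ≤ ncFx n (ncR x y) := by
    intro v hv
    rw [ncFx_ncR hx hy hxy]
    have : ncExt n v x - ncExt n v y = 0 := hv
    linarith
  have h1 := Submodule.finrank_mono hk
  have h2 := LinearMap.finrank_range_add_finrank_ker (ncFun n x y)
  have h3 := Submodule.finrank_le (LinearMap.range (ncFun n x y))
  rw [finrank_euclideanSpace_fin] at h2
  rw [Module.finrank_self] at h3
  have := ncCd_add n (ncR x y)
  omega

theorem ncCd_gen {n : ℕ} {t : Equiv.Perm ℤ} (h : t ∈ genB n) : ncCd n t ≤ 1 := by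
  obtain ⟨x, y, hx, hy, hxy, rfl⟩ := genB_iff.mp h
  exact ncCd_ncR hx.1 hy.1 hxy

theorem ncCd_one (n : ℕ) : ncCd n 1 = 0 := by
  have : ncFx n 1 = ⊤ := by
    rw [eq_top_iff]; intro v _ z; rfl
  have h := ncCd_add n 1
  rw [this, finrank_top, finrank_euclideanSpace_fin] at h
  omega

theorem ncCd_list {n : ℕ} (l : List (Equiv.Perm ℤ)) (h : ∀ g ∈ l, g ∈ genB n) : ncCd n l.prod ≤ l.length := by
  induction l with
  | nil => simp [ncCd_one]
  | cons a l ih =>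
    rw [List.prod_cons, List.length_cons]
    have h1 := ncCd_mul n a l.prod
    have h2 := ncCd_gen (h a (by simp))
    have h3 := ih fun g hg => h g (by simp [hg])
    omega

/-- odd indicator of a set -/
noncomputable def ncInd (n : ℕ) (S : Set ℤ) : ncSp n := by
  classical
  exact ncRes n fun z => (if z ∈ S then 1 else 0) - (if -z ∈ S then 1 else 0)

open Classical in
theorem ncExt_ncInd {n : ℕ} {S : Set ℤ} (hS : S ⊆ signedSet n) (z : ℤ) :
    ncExt n (ncInd n S) z = (if z ∈ S then 1 else 0) - (if -z ∈ S then 1 else 0) := by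
  unfold ncInd
  rw [ncExt_ncRes (u := fun z => (if z ∈ S then 1 else 0) - (if -z ∈ S then 1 else 0))]
  · intro z; simp
  · intro z hz
    have h1 : z ∉ S := fun h => hz (hS h)
    have h2 : -z ∉ S := fun h => hz (nc_neg_mem_X.mp (hS h))
    simp [h1, h2]

theorem ncInd_mem {n : ℕ} {S : Set ℤ} (hS : S ⊆ signedSet n) {τ : Equiv.Perm ℤ} (hτ : inB n τ) (h : ∀ z, τ z ∈ S ↔ z ∈ S) :
    ncInd n S ∈ ncFx n τ := by
  classical
  intro z
  rw [ncExt_ncInd hS, ncExt_ncInd hS, ← hτ.1, h, h]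

theorem nc_exists_down {n : ℕ} {τ : Equiv.Perm ℤ} (hτ : inB n τ) (h : τ ≠ 1) :
    ∃ t ∈ genB n, ncCd n (t * τ) < ncCd n τ ∧ t * t = 1 := by
  classical
  obtain ⟨x, hx⟩ : ∃ x, τ x ≠ x := by
    by_contra hc
    push Not at hc
    exact h (Equiv.ext hc)
  have hxX : x ∈ signedSet n := by
    by_contra hc
    exact hx (hτ.2 x hc)
  have hyX := (hτ.mem_iff x).mpr hxX
  refine ⟨ncR x (τ x), genB_iff.mpr ⟨x, τ x, hxX, hyX, hx.symm, rfl⟩, ?_, ncR_mul_self hxX.1 hyX.1 hx.symm⟩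
  have hlt : ncFx n τ < ncFx n (ncR x (τ x) * τ) := by
    refine lt_of_le_of_ne ?_ ?_
    · intro v hv
      exact ncFx_mul n _ _ ⟨(ncFx_ncR hxX.1 hyX.1 hx.symm v).mpr (hv x).symm, hv⟩
    · intro he
      have hs : ({x} : Set ℤ) ⊆ signedSet n := by simpa using hxX
      have h1 : ncInd n {x} ∈ ncFx n (ncR x (τ x) * τ) := by
        apply ncInd_mem hs ((ncR_inB hxX hyX hx.symm).mul hτ)
        intro z
        simp only [Set.mem_singleton_iff]
        have hf : (ncR x (τ x) * τ) x = x := by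
          rw [Equiv.Perm.mul_apply, ncR_right hxX.1 hyX.1 hx.symm]
        constructor
        · intro hz; exact (ncR x (τ x) * τ).injective (hz.trans hf.symm)
        · rintro rfl; exact hf
      rw [← he] at h1
      have h2 := h1 x
      rw [ncExt_ncInd hs, ncExt_ncInd hs] at h2
      have hx0 := hxX.1
      simp only [Set.mem_singleton_iff, hx, if_false, if_true, show ¬ (-x = x) by omega] at h2
      split_ifs at h2 <;> norm_num at h2
  have := Submodule.finrank_lt_finrank_of_lt hlt
  have := ncCd_add n τ
  have := ncCd_add n (ncR x (τ x) * τ)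
  omega

theorem ncCd_eq_zero {n : ℕ} {τ : Equiv.Perm ℤ} (hτ : inB n τ) (h : ncCd n τ = 0) : τ = 1 := by
  by_contra hc
  obtain ⟨t, _, h2, _⟩ := nc_exists_down hτ hc
  omega

theorem nc_carter {n : ℕ} (k : ℕ) {τ : Equiv.Perm ℤ} (hτ : inB n τ) (hk : ncCd n τ = k) :
    ∃ l : List (Equiv.Perm ℤ), l.length = k ∧ (∀ g ∈ l, g ∈ genB n) ∧ l.prod = τ := by
  induction k generalizing τ with
  | zero => exact ⟨[], rfl, by simp, (ncCd_eq_zero hτ hk).symm⟩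
  | succ k ih =>
    have hne : τ ≠ 1 := by rintro rfl; rw [ncCd_one] at hk; omega
    obtain ⟨t, ht, hlt, htt⟩ := nc_exists_down hτ hne
    have hτ' : τ = t * (t * τ) := by rw [← mul_assoc, htt, one_mul]
    have h1 := ncCd_mul n t (t * τ)
    rw [← hτ'] at h1
    have h2 := ncCd_gen ht
    obtain ⟨l, hl1, hl2, hl3⟩ := ih ((genB_inB ht).mul hτ) (by omega)
    refine ⟨t :: l, by simp [hl1], ?_, ?_⟩
    · intro g hg
      rcases List.mem_cons.mp hg with rfl | hg
      · exact ht
      · exact hl2 g hg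
    · rw [List.prod_cons, hl3, ← hτ']

theorem nc_lenB {n : ℕ} {τ : Equiv.Perm ℤ} (hτ : inB n τ) : lenB n τ = ncCd n τ := by
  unfold lenB
  apply le_antisymm
  · exact Nat.sInf_le (nc_carter _ hτ rfl)
  · apply le_csInf
    · exact ⟨_, nc_carter _ hτ rfl⟩
    · rintro k ⟨l, rfl, hl, rfl⟩
      exact ncCd_list l hl

end LinPart


section BWPart

theorem nc_mem_rel {n : ℕ} {σ τ : Equiv.Perm ℤ} (hσ : inB n σ) (hτ : inB n τ) (v : ncSp n) :
    v ∈ ncFx n (σ⁻¹ * τ) ↔ ncAct n σ⁻¹ v = ncAct n τ⁻¹ v := by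
  rw [mem_ncFx]
  constructor
  · intro h
    apply ncExt_inj
    intro z
    rw [ncExt_ncAct hσ.inv, ncExt_ncAct hτ.inv]
    have := h (τ⁻¹ z)
    simpa using this
  · intro h z
    have := ncExt_ncAct hσ.inv v (τ z)
    rw [h, ncExt_ncAct hτ.inv] at this
    simpa using this.symm

theorem nc_mem_fx' {n : ℕ} {τ : Equiv.Perm ℤ} (hτ : inB n τ) (v : ncSp n) :
    v ∈ ncFx n τ ↔ ncAct n τ⁻¹ v = v := by
  rw [← ncFx_inv, mem_ncFx]
  constructor
  · intro h
    apply ncExt_inj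
    intro z
    rw [ncExt_ncAct hτ.inv, h]
  · intro h z
    rw [← ncExt_ncAct hτ.inv, h]

theorem nc_K_eq {n : ℕ} {γ τ : Equiv.Perm ℤ} (hγ : inB n γ) (hτ : inB n τ)
    (hg : ncFx n γ = ⊥) (d : ncCd n τ + ncCd n (τ⁻¹ * γ) = n) :
    ncFx n (τ⁻¹ * γ) = Submodule.comap (ncAct n γ⁻¹ - LinearMap.id) (ncFx n τ)ᗮ := by
  have hinj : Function.Injective (ncAct n γ⁻¹ - LinearMap.id : ncSp n →ₗ[ℝ] ncSp n) := by
    rw [injective_iff_map_eq_zero]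
    intro v hv
    have : v ∈ ncFx n γ := by
      rw [nc_mem_fx' hγ]
      rw [LinearMap.sub_apply, LinearMap.id_apply, sub_eq_zero] at hv
      exact hv
    rw [hg] at this
    simpa using this
  have hle : ncFx n (τ⁻¹ * γ) ≤ Submodule.comap (ncAct n γ⁻¹ - LinearMap.id) (ncFx n τ)ᗮ := by
    intro v hv
    rw [Submodule.mem_comap, Submodule.mem_orthogonal]
    intro k hk
    rw [nc_mem_rel hτ hγ] at hv
    rw [nc_mem_fx' hτ] at hk
    rw [LinearMap.sub_apply, LinearMap.id_apply, ← hv, inner_sub_right]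
    have := ncAct_inner hτ.inv k v
    rw [hk] at this
    rw [this, sub_self]
  apply Submodule.eq_of_le_of_finrank_le hle
  have h1 : Module.finrank ℝ (Submodule.comap (ncAct n γ⁻¹ - LinearMap.id) (ncFx n τ)ᗮ)
      ≤ Module.finrank ℝ ((ncFx n τ)ᗮ : Submodule ℝ (ncSp n)) := by
    rw [(Submodule.equivMapOfInjective _ hinj _).finrank_eq]
    exact Submodule.finrank_mono (Submodule.map_comap_le _ _)
  have h2 := Submodule.finrank_add_finrank_orthogonal (ncFx n τ)
  rw [finrank_euclideanSpace_fin] at h2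
  have := ncCd_add n τ
  have := ncCd_add n (τ⁻¹ * γ)
  omega

theorem nc_BW {n : ℕ} {γ τ₁ τ₂ : Equiv.Perm ℤ} (hγ : inB n γ) (h1 : inB n τ₁) (h2 : inB n τ₂)
    (hg : ncFx n γ = ⊥) (d1 : ncCd n τ₁ + ncCd n (τ₁⁻¹ * γ) = n)
    (d2 : ncCd n τ₂ + ncCd n (τ₂⁻¹ * γ) = n) (hF : ncFx n τ₂ ≤ ncFx n τ₁) :
    ncCd n τ₁ + ncCd n (τ₁⁻¹ * τ₂) = ncCd n τ₂ := by
  have hK : ncFx n (τ₁⁻¹ * γ) ≤ ncFx n (τ₂⁻¹ * γ) := by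
    rw [nc_K_eq hγ h1 hg d1, nc_K_eq hγ h2 hg d2]
    exact Submodule.comap_mono (Submodule.orthogonal_le hF)
  have hsup : ncFx n τ₂ ⊔ ncFx n (τ₁⁻¹ * γ) ≤ ncFx n (τ₁⁻¹ * τ₂) := by
    apply sup_le
    · intro v hv
      have hv' := hF hv
      rw [nc_mem_fx' h2] at hv
      rw [nc_mem_fx' h1] at hv'
      rw [nc_mem_rel h1 h2, hv, hv']
    · intro v hv
      have hv' := hK hv
      rw [nc_mem_rel h1 hγ] at hv
      rw [nc_mem_rel h2 hγ] at hv'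
      rw [nc_mem_rel h1 h2, hv, hv']
  have hinf : ncFx n τ₂ ⊓ ncFx n (τ₁⁻¹ * γ) = ⊥ := by
    rw [eq_bot_iff, ← hg]
    rintro v ⟨ha, hb⟩
    have ha' := hF ha
    have hb : v ∈ ncFx n (τ₁⁻¹ * γ) := hb
    rw [nc_mem_fx' h1] at ha'
    rw [nc_mem_rel h1 hγ] at hb
    rw [nc_mem_fx' hγ, ← hb, ha']
  have e1 := Submodule.finrank_mono hsup
  have e2 := Submodule.finrank_sup_add_finrank_inf_eq (ncFx n τ₂) (ncFx n (τ₁⁻¹ * γ))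
  rw [hinf, finrank_bot] at e2
  have e3 := ncCd_mul n τ₁ (τ₁⁻¹ * τ₂)
  rw [mul_inv_cancel_left] at e3
  have := ncCd_add n τ₁
  have := ncCd_add n τ₂
  have := ncCd_add n (τ₁⁻¹ * γ)
  have := ncCd_add n (τ₁⁻¹ * τ₂)
  omega

/-! ### Partitions -/

def ncBlk (n : ℕ) (W : Submodule ℝ (ncSp n)) (x : ℤ) : Set ℤ :=
  {y | y ∈ signedSet n ∧ ∀ v ∈ W, ncExt n v x = ncExt n v y}

theorem nc_orb_self (τ : Equiv.Perm ℤ) (x : ℤ) : x ∈ permOrbit τ x := ⟨0, rfl⟩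

theorem nc_orb_step (τ : Equiv.Perm ℤ) (x z : ℤ) : τ z ∈ permOrbit τ x ↔ z ∈ permOrbit τ x := by
  constructor
  · rintro ⟨m, hm⟩
    refine ⟨m - 1, ?_⟩
    rw [sub_eq_neg_add, zpow_add, Equiv.Perm.mul_apply, hm]
    simp
  · rintro ⟨m, hm⟩
    refine ⟨1 + m, ?_⟩
    rw [zpow_add, Equiv.Perm.mul_apply, hm]
    simp

theorem nc_zpow_fx {n : ℕ} {τ : Equiv.Perm ℤ} {v : ncSp n} (hv : v ∈ ncFx n τ) (m : ℤ) (x : ℤ) :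
    ncExt n v ((τ ^ m) x) = ncExt n v x := by
  have hn : ∀ (k : ℕ) (x : ℤ), ncExt n v ((τ ^ k) x) = ncExt n v x := by
    intro k
    induction k with
    | zero => intro x; rfl
    | succ k ih => intro x; rw [pow_succ, Equiv.Perm.mul_apply, ih, hv]
  rcases Int.eq_nat_or_neg m with ⟨k, rfl | rfl⟩
  · rw [zpow_natCast]; exact hn k x
  · have := hn k ((τ ^ (-(k : ℤ))) x)
    rw [← this, zpow_neg, zpow_natCast]; simp

theorem nc_orb_fx {n : ℕ} {τ : Equiv.Perm ℤ} {x y : ℤ} (h : y ∈ permOrbit τ x) {v : ncSp n} (hv : v ∈ ncFx n τ) :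
    ncExt n v x = ncExt n v y := by
  obtain ⟨m, rfl⟩ := h
  rw [nc_zpow_fx hv]

theorem nc_zpow_neg {n : ℕ} {τ : Equiv.Perm ℤ} (hτ : inB n τ) (m x : ℤ) : (τ ^ m) (-x) = -((τ ^ m) x) := by
  rcases Int.eq_nat_or_neg m with ⟨k, rfl | rfl⟩
  · rw [zpow_natCast]; exact (hτ.pow k).1 x
  · rw [zpow_neg, zpow_natCast]; exact (hτ.pow k).inv.1 x

theorem nc_orb_sub {n : ℕ} {τ : Equiv.Perm ℤ} (hτ : inB n τ) {x : ℤ} (hx : x ∈ signedSet n) :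
    permOrbit τ x ⊆ signedSet n := by
  rintro y ⟨m, rfl⟩
  rcases Int.eq_nat_or_neg m with ⟨k, rfl | rfl⟩
  · rw [zpow_natCast]; exact ((hτ.pow k).mem_iff x).mpr hx
  · rw [zpow_neg, zpow_natCast]; exact ((hτ.pow k).inv.mem_iff x).mpr hx

theorem nc_orb_eq {τ : Equiv.Perm ℤ} {x y : ℤ} (h : y ∈ permOrbit τ x) : permOrbit τ y = permOrbit τ x := by
  obtain ⟨m, rfl⟩ := h
  ext z
  constructor
  · rintro ⟨k, rfl⟩; exact ⟨k + m, by rw [zpow_add]; rfl⟩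
  · rintro ⟨k, rfl⟩; exact ⟨k - m, by rw [← Equiv.Perm.mul_apply, ← zpow_add]; simp⟩

theorem nc_orb_neg {n : ℕ} {τ : Equiv.Perm ℤ} (hτ : inB n τ) (x : ℤ) :
    negSet (permOrbit τ x) = permOrbit τ (-x) := by
  ext z
  constructor
  · rintro ⟨m, hm⟩; exact ⟨m, by rw [nc_zpow_neg hτ, hm, neg_neg]⟩
  · rintro ⟨m, hm⟩; exact ⟨m, by rw [nc_zpow_neg hτ] at hm; rw [← hm, neg_neg]⟩

theorem nc_bal {n : ℕ} {τ : Equiv.Perm ℤ} (hτ : inB n τ) {x : ℤ}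
    (h : negSet (permOrbit τ x) = permOrbit τ x) {v : ncSp n} (hv : v ∈ ncFx n τ) : ncExt n v x = 0 := by
  rw [nc_orb_neg hτ] at h
  have : -x ∈ permOrbit τ x := by rw [← h]; exact nc_orb_self _ _
  have := nc_orb_fx this hv
  rw [ncExt_neg] at this
  linarith

theorem nc_unbal {n : ℕ} {τ : Equiv.Perm ℤ} (hτ : inB n τ) {x : ℤ} (hx : x ∈ signedSet n)
    (h : negSet (permOrbit τ x) ≠ permOrbit τ x) :
    ∃ v ∈ ncFx n τ, ncExt n v x = 1 ∧ ∀ y, ncExt n v y = 1 → y ∈ permOrbit τ x := by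
  classical
  have hs := nc_orb_sub hτ hx
  have hno : -x ∉ permOrbit τ x := by
    intro hc
    rw [nc_orb_neg hτ, nc_orb_eq hc] at h
    exact h rfl
  refine ⟨ncInd n (permOrbit τ x), ncInd_mem hs hτ (nc_orb_step τ x), ?_, ?_⟩
  · rw [ncExt_ncInd hs, if_pos (nc_orb_self _ _), if_neg hno, sub_zero]
  · intro y hy
    rw [ncExt_ncInd hs] at hy
    by_contra hc
    rw [if_neg hc] at hy
    split_ifs at hy <;> norm_num at hy

theorem nc_omega {n : ℕ} {τ : Equiv.Perm ℤ} (hτ : inB n τ) :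
    omegaTilde n τ = {A | ∃ x ∈ signedSet n, A = ncBlk n (ncFx n τ) x} := by
  have hU : ∀ x ∈ signedSet n, negSet (permOrbit τ x) ≠ permOrbit τ x →
      permOrbit τ x = ncBlk n (ncFx n τ) x := by
    intro x hx h
    obtain ⟨v, hv, h1, h2⟩ := nc_unbal hτ hx h
    ext y
    constructor
    · intro hy; exact ⟨nc_orb_sub hτ hx hy, fun v hv => nc_orb_fx hy hv⟩
    · rintro ⟨_, hy⟩; exact h2 y (by rw [← hy v hv, h1])
  have hB : ∀ x ∈ signedSet n, negSet (permOrbit τ x) = permOrbit τ x →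
      ⋃₀ {A | A ∈ orbitsOn n τ ∧ negSet A = A} = ncBlk n (ncFx n τ) x := by
    intro x hx h
    ext y
    constructor
    · rintro ⟨A, ⟨⟨z, hz, rfl⟩, hA⟩, hy⟩
      refine ⟨nc_orb_sub hτ hz hy, fun v hv => ?_⟩
      rw [nc_bal hτ h hv, ← nc_orb_fx hy hv, nc_bal hτ hA hv]
    · rintro ⟨hy, hy2⟩
      refine ⟨permOrbit τ y, ⟨⟨y, hy, rfl⟩, ?_⟩, nc_orb_self _ _⟩
      by_contra hc
      obtain ⟨v, hv, h1, h2⟩ := nc_unbal hτ hy hc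
      have := hy2 v hv
      rw [nc_bal hτ h hv, h1] at this
      norm_num at this
  ext A
  constructor
  · rintro (⟨⟨x, hx, rfl⟩, hA⟩ | ⟨rfl, y, A, ⟨⟨x, hx, rfl⟩, hA⟩, hy⟩)
    · exact ⟨x, hx, hU x hx hA⟩
    · exact ⟨x, hx, hB x hx hA⟩
  · rintro ⟨x, hx, rfl⟩
    by_cases h : negSet (permOrbit τ x) = permOrbit τ x
    · right
      exact ⟨(hB x hx h).symm, x, hx, fun _ _ => rfl⟩
    · left
      rw [← hU x hx h]
      exact ⟨⟨x, hx, rfl⟩, h⟩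

theorem nc_refines {n : ℕ} {τ₁ τ₂ : Equiv.Perm ℤ} (h1 : inB n τ₁) (h2 : inB n τ₂) :
    refines (omegaTilde n τ₁) (omegaTilde n τ₂) ↔ ncFx n τ₂ ≤ ncFx n τ₁ := by
  rw [nc_omega h1, nc_omega h2]
  constructor
  · intro h v hv z
    by_cases hz : z ∈ signedSet n
    · obtain ⟨B, ⟨x, hx, rfl⟩, hB⟩ := h (ncBlk n (ncFx n τ₁) z) ⟨z, hz, rfl⟩
      have a1 := hB (show z ∈ ncBlk n (ncFx n τ₁) z from ⟨hz, fun _ _ => rfl⟩)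
      have a2 := hB (show τ₁ z ∈ ncBlk n (ncFx n τ₁) z from
        ⟨(h1.mem_iff z).mpr hz, fun w hw => (hw z).symm⟩)
      rw [← a1.2 v hv, ← a2.2 v hv]
    · rw [h1.2 z hz]
  · rintro h A ⟨x, hx, rfl⟩
    exact ⟨_, ⟨x, hx, rfl⟩, fun y hy => ⟨hy.1, fun v hv => hy.2 v (h hv)⟩⟩

end BWPart


section ChainPart

def ncS (n : ℕ) (γ τ : Equiv.Perm ℤ) : Prop := inB n τ ∧ ncCd n τ + ncCd n (τ⁻¹ * γ) = n

theorem nc_cd_top {n : ℕ} {γ : Equiv.Perm ℤ} (hg : ncFx n γ = ⊥) : ncCd n γ = n := by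
  have := ncCd_add n γ
  rw [hg, finrank_bot] at this
  simpa using this

theorem nc_S_cd_le {n : ℕ} {γ τ : Equiv.Perm ℤ} (h : ncS n γ τ) : ncCd n τ ≤ n := by
  have := h.2; omega

theorem nc_F1 {n : ℕ} {γ τ₁ τ₂ : Equiv.Perm ℤ} (hγ : inB n γ) (hg : ncFx n γ = ⊥) (h1 : ncS n γ τ₁)
    (h2 : ncS n γ τ₂) (h : ncFx n τ₂ ≤ ncFx n τ₁) :
    ncCd n τ₁ + ncCd n (τ₁⁻¹ * τ₂) = ncCd n τ₂ :=
  nc_BW hγ h1.1 h2.1 hg h1.2 h2.2 h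

theorem nc_F2 {n : ℕ} {γ τ₁ τ₂ : Equiv.Perm ℤ} (hγ : inB n γ) (hg : ncFx n γ = ⊥) (h1 : ncS n γ τ₁)
    (h2 : ncS n γ τ₂) (h : ncFx n τ₂ ≤ ncFx n τ₁) (hc : ncCd n τ₂ ≤ ncCd n τ₁) : τ₁ = τ₂ := by
  have := nc_F1 hγ hg h1 h2 h
  have := ncCd_eq_zero (h1.1.inv.mul h2.1) (by omega)
  rwa [inv_mul_eq_one] at this

theorem nc_F3 {n : ℕ} {γ τ σ : Equiv.Perm ℤ} (hγ : inB n γ) (hg : ncFx n γ = ⊥) (h1 : ncS n γ τ)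
    (h2 : ncS n γ σ) (h : ncFx n σ ≤ ncFx n τ) (hc : ncCd n τ < ncCd n σ) :
    ∃ ρ, ncS n γ ρ ∧ ncFx n σ ≤ ncFx n ρ ∧ ncFx n ρ ≤ ncFx n τ ∧ ncCd n ρ = ncCd n τ + 1 := by
  have e1 := nc_F1 hγ hg h1 h2 h
  have e0 := nc_cd_top hg
  obtain ⟨k, hk⟩ : ∃ k, ncCd n (τ⁻¹ * σ) = k + 1 := ⟨ncCd n (τ⁻¹ * σ) - 1, by omega⟩
  obtain ⟨l, hl1, hl2, hl3⟩ := nc_carter _ (h1.1.inv.mul h2.1) hk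
  cases l with
  | nil => simp at hl1
  | cons t m =>
    have ht := hl2 t (by simp)
    have hm := ncCd_list m (fun g hg => hl2 g (by simp [hg]))
    have hσ : σ = τ * t * m.prod := by
      rw [List.prod_cons] at hl3
      rw [mul_assoc, hl3]; simp
    have hlen : m.length = k := by simpa using hl1
    have c1 := ncCd_gen ht
    have c2 := ncCd_mul n τ t
    have c3 := ncCd_mul n m.prod (σ⁻¹ * γ)
    have c4 : m.prod * (σ⁻¹ * γ) = (τ * t)⁻¹ * γ := by rw [hσ]; group
    rw [c4] at c3
    have c5 := ncCd_mul n (τ * t) ((τ * t)⁻¹ * γ)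
    rw [mul_inv_cancel_left] at c5
    have c6 := ncCd_mul n (τ * t) m.prod
    rw [← hσ] at c6
    have h22 := h2.2
    refine ⟨τ * t, ⟨h1.1.mul (genB_inB ht), by omega⟩, ?_, ?_, by omega⟩
    · have := ncFx_of_le n (τ * t) m.prod (by rw [← hσ]; omega)
      rw [← hσ] at this
      exact this.trans inf_le_left
    · exact (ncFx_of_le n τ t (by omega)).trans inf_le_left

theorem nc_S_one {n : ℕ} {γ : Equiv.Perm ℤ} (hg : ncFx n γ = ⊥) : ncS n γ 1 := by
  refine ⟨inB_one n, ?_⟩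
  rw [ncCd_one, inv_one, one_mul, nc_cd_top hg, zero_add]

theorem nc_S_top {n : ℕ} {γ : Equiv.Perm ℤ} (hγ : inB n γ) (hg : ncFx n γ = ⊥) : ncS n γ γ := by
  refine ⟨hγ, ?_⟩
  rw [inv_mul_cancel, ncCd_one, nc_cd_top hg, add_zero]

theorem nc_fx_one (n : ℕ) : ncFx n 1 = ⊤ := by
  rw [eq_top_iff]; intro v _ z; rfl

/-- the set of factorizations -/
def ncL (n : ℕ) (γ : Equiv.Perm ℤ) : Set (List (Equiv.Perm ℤ)) :=
  {l | l.length = n ∧ (∀ g ∈ l, g ∈ genB n) ∧ l.prod = γ}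

theorem nc_L_part {n : ℕ} {γ : Equiv.Perm ℤ} (hg : ncFx n γ = ⊥) {l : List (Equiv.Perm ℤ)}
    (hl : l ∈ ncL n γ) {i : ℕ} (hi : i ≤ n) :
    ncS n γ (l.take i).prod ∧ ncCd n (l.take i).prod = i := by
  obtain ⟨h1, h2, h3⟩ := hl
  have e0 := nc_cd_top hg
  have a1 := ncCd_list (l.take i) (fun g hg => h2 g (List.mem_of_mem_take hg))
  have a2 := ncCd_list (l.drop i) (fun g hg => h2 g (List.mem_of_mem_drop hg))
  have a3 : (l.take i).prod * (l.drop i).prod = γ := by rw [List.prod_take_mul_prod_drop, h3]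
  have a4 : (l.drop i).prod = (l.take i).prod⁻¹ * γ := by rw [← a3]; group
  have a5 := ncCd_mul n (l.take i).prod (l.drop i).prod
  rw [a3] at a5
  simp only [List.length_take, List.length_drop] at a1 a2
  refine ⟨⟨inB_list _ fun g hg => h2 g (List.mem_of_mem_take hg), ?_⟩, by omega⟩
  rw [← a4]; omega

theorem nc_L_mono {n : ℕ} {γ : Equiv.Perm ℤ} (hg : ncFx n γ = ⊥) {l : List (Equiv.Perm ℤ)}
    (hl : l ∈ ncL n γ) {i j : ℕ} (hij : i ≤ j) (hj : j ≤ n) :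
    ncFx n (l.take j).prod ≤ ncFx n (l.take i).prod := by
  have hi := nc_L_part hg hl (hij.trans hj)
  have hj' := nc_L_part hg hl hj
  have e : (l.take j) = l.take i ++ (l.take j).drop i := by
    conv_lhs => rw [← List.take_append_drop i (l.take j)]
    rw [List.take_take, min_eq_left hij]
  have ep : (l.take j).prod = (l.take i).prod * ((l.take j).drop i).prod := by
    conv_lhs => rw [e]
    rw [List.prod_append]
  have a2 := ncCd_list ((l.take j).drop i)
    (fun g hg => hl.2.1 g (List.mem_of_mem_take (List.mem_of_mem_drop hg)))
  simp only [List.length_take, List.length_drop] at a2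
  have := ncFx_of_le n (l.take i).prod ((l.take j).drop i).prod (by rw [← ep, hi.2, hj'.2]; omega)
  rw [← ep] at this
  exact this.trans inf_le_left

def ncPhi (n : ℕ) (l : List (Equiv.Perm ℤ)) : Set (Set (Set ℤ)) :=
  {π | ∃ i ≤ n, π = omegaTilde n (l.take i).prod}

def ncP (n : ℕ) (γ : Equiv.Perm ℤ) : Set (Set (Set ℤ)) := {π | ∃ τ, ncS n γ τ ∧ π = omegaTilde n τ}

def ncMax (n : ℕ) (γ : Equiv.Perm ℤ) : Set (Set (Set (Set ℤ))) :=
  {C | C ⊆ ncP n γ ∧ IsChain refines C ∧ ∀ D : Set (Set (Set ℤ)), D ⊆ ncP n γ → IsChain refines D → C ⊆ D → C = D}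

theorem nc_chain_cmp {n : ℕ} {C : Set (Set (Set ℤ))} (hC : IsChain refines C) {τ σ : Equiv.Perm ℤ}
    (hτ : inB n τ) (hσ : inB n σ) (h1 : omegaTilde n τ ∈ C) (h2 : omegaTilde n σ ∈ C) :
    ncFx n σ ≤ ncFx n τ ∨ ncFx n τ ≤ ncFx n σ := by
  by_cases h : omegaTilde n τ = omegaTilde n σ
  · left
    rw [← nc_refines hτ hσ, h]
    exact fun A hA => ⟨A, hA, subset_rfl⟩
  · rcases hC h1 h2 h with h | h
    · left; exact (nc_refines hτ hσ).mp h
    · right; exact (nc_refines hσ hτ).mp h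

theorem nc_omega_inj {n : ℕ} {γ : Equiv.Perm ℤ} (hγ : inB n γ) (hg : ncFx n γ = ⊥) {τ σ : Equiv.Perm ℤ}
    (hτ : ncS n γ τ) (hσ : ncS n γ σ) (h : omegaTilde n τ = omegaTilde n σ) : τ = σ := by
  have r : ∀ π, refines π π := fun π A hA => ⟨A, hA, subset_rfl⟩
  have h1 : ncFx n σ ≤ ncFx n τ := by rw [← nc_refines hτ.1 hσ.1, h]; exact r _
  have h2 : ncFx n τ ≤ ncFx n σ := by rw [← nc_refines hσ.1 hτ.1, h]; exact r _
  apply nc_F2 hγ hg hτ hσ h1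
  unfold ncCd
  rw [le_antisymm h1 h2]

theorem nc_chain_same {n : ℕ} {γ : Equiv.Perm ℤ} (hγ : inB n γ) (hg : ncFx n γ = ⊥) {C : Set (Set (Set ℤ))}
    (hC : IsChain refines C) {τ σ : Equiv.Perm ℤ} (hτ : ncS n γ τ) (hσ : ncS n γ σ)
    (h1 : omegaTilde n τ ∈ C) (h2 : omegaTilde n σ ∈ C) (h : ncCd n τ ≤ ncCd n σ) : ncFx n σ ≤ ncFx n τ := by
  rcases nc_chain_cmp hC hτ.1 hσ.1 h1 h2 with h' | h'
  · exact h'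
  · rw [nc_F2 hγ hg hσ hτ h' h]

theorem nc_Phi_max {n : ℕ} {γ : Equiv.Perm ℤ} (hγ : inB n γ) (hg : ncFx n γ = ⊥) {l : List (Equiv.Perm ℤ)}
    (hl : l ∈ ncL n γ) : ncPhi n l ∈ ncMax n γ := by
  refine ⟨?_, ?_, ?_⟩
  · rintro π ⟨i, hi, rfl⟩
    exact ⟨_, (nc_L_part hg hl hi).1, rfl⟩
  · rintro π ⟨i, hi, rfl⟩ ρ ⟨j, hj, rfl⟩ _
    have a := (nc_L_part hg hl hi).1.1
    have b := (nc_L_part hg hl hj).1.1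
    rcases le_total i j with h | h
    · left; exact (nc_refines a b).mpr (nc_L_mono hg hl h hj)
    · right; exact (nc_refines b a).mpr (nc_L_mono hg hl h hi)
  · intro D hD hDc hsub
    apply subset_antisymm hsub
    intro π hπ
    obtain ⟨τ, hτ, rfl⟩ := hD hπ
    have hle := nc_S_cd_le hτ
    have hp := nc_L_part hg hl hle
    refine ⟨ncCd n τ, hle, ?_⟩
    have hm : omegaTilde n (l.take (ncCd n τ)).prod ∈ D := hsub ⟨_, hle, rfl⟩
    rw [nc_F2 hγ hg hp.1 hτ (nc_chain_same hγ hg hDc hp.1 hτ hm hπ hp.2.le) hp.2.ge]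

theorem nc_Phi_inj {n : ℕ} {γ : Equiv.Perm ℤ} (hγ : inB n γ) (hg : ncFx n γ = ⊥) :
    Set.InjOn (ncPhi n) (ncL n γ) := by
  intro l hl l' hl' h
  have key : ∀ i ≤ n, (l.take i).prod = (l'.take i).prod := by
    intro i hi
    have : omegaTilde n (l.take i).prod ∈ ncPhi n l' := by rw [← h]; exact ⟨i, hi, rfl⟩
    obtain ⟨j, hj, he⟩ := this
    have a := nc_L_part hg hl hi
    have b := nc_L_part hg hl' hj
    have := nc_omega_inj hγ hg a.1 b.1 he
    have e : i = j := by rw [← a.2, ← b.2, this]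
    rw [this, e]
  apply List.ext_getElem (by rw [hl.1, hl'.1])
  intro i h1 h2
  have a := key i (by have := hl.1; omega)
  have b := key (i + 1) (by have := hl.1; omega)
  rw [List.prod_take_succ _ _ h1, List.prod_take_succ _ _ h2, a] at b
  exact mul_left_cancel b

theorem nc_max_insert {n : ℕ} {γ : Equiv.Perm ℤ} {C : Set (Set (Set ℤ))} (hC : C ∈ ncMax n γ)
    {ρ : Equiv.Perm ℤ} (hρ : ncS n γ ρ) (h : ∀ θ, ncS n γ θ → omegaTilde n θ ∈ C → ncFx n ρ ≤ ncFx n θ ∨ ncFx n θ ≤ ncFx n ρ) :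
    omegaTilde n ρ ∈ C := by
  have := hC.2.2 (insert (omegaTilde n ρ) C) ?_ ?_ (Set.subset_insert _ _)
  · rw [this]; exact Set.mem_insert _ _
  · rintro π (rfl | hπ)
    · exact ⟨ρ, hρ, rfl⟩
    · exact hC.1 hπ
  · apply hC.2.1.insert
    intro π hπ _
    obtain ⟨θ, hθ, rfl⟩ := hC.1 hπ
    rw [nc_refines hρ.1 hθ.1, nc_refines hθ.1 hρ.1]
    exact (h θ hθ hπ).symm

theorem nc_max_rank {n : ℕ} {γ : Equiv.Perm ℤ} (hγ : inB n γ) (hg : ncFx n γ = ⊥) {C : Set (Set (Set ℤ))} (hC : C ∈ ncMax n γ)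
    (i : ℕ) (hi : i ≤ n) : ∃ τ, ncS n γ τ ∧ ncCd n τ = i ∧ omegaTilde n τ ∈ C := by
  classical
  induction i with
  | zero =>
    refine ⟨1, nc_S_one hg, ncCd_one n, nc_max_insert hC (nc_S_one hg) ?_⟩
    intro θ _ _
    right; rw [nc_fx_one]; exact le_top
  | succ i ih =>
    obtain ⟨τ, hτ, hτi, hτC⟩ := ih (by omega)
    have hex : ∃ j, i < j ∧ ∃ σ, ncS n γ σ ∧ ncCd n σ = j ∧ omegaTilde n σ ∈ C := by
      refine ⟨n, by omega, γ, nc_S_top hγ hg, nc_cd_top hg, nc_max_insert hC (nc_S_top hγ hg) ?_⟩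
      intro θ _ _
      left; rw [hg]; exact bot_le
    obtain ⟨h1, σ, hσ, hσj, hσC⟩ := Nat.find_spec hex
    have hmin : ∀ θ, ncS n γ θ → omegaTilde n θ ∈ C → i < ncCd n θ → ncCd n σ ≤ ncCd n θ := by
      intro θ hθ hθC hlt
      rw [hσj]
      exact Nat.find_min' hex ⟨hlt, θ, hθ, rfl, hθC⟩
    obtain ⟨ρ, hρ, r1, r2, r3⟩ := nc_F3 hγ hg hτ hσ (nc_chain_same hγ hg hC.2.1 hτ hσ hτC hσC (by omega)) (by omega)
    refine ⟨ρ, hρ, by omega, nc_max_insert hC hρ ?_⟩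
    intro θ hθ hθC
    rcases Nat.lt_or_ge i (ncCd n θ) with h | h
    · right
      exact (nc_chain_same hγ hg hC.2.1 hσ hθ hσC hθC (hmin θ hθ hθC h)).trans r1
    · left
      exact r2.trans (nc_chain_same hγ hg hC.2.1 hθ hτ hθC hτC (by omega))

theorem nc_Phi_surj {n : ℕ} {γ : Equiv.Perm ℤ} (hγ : inB n γ) (hg : ncFx n γ = ⊥) {C : Set (Set (Set ℤ))} (hC : C ∈ ncMax n γ) :
    ∃ l ∈ ncL n γ, ncPhi n l = C := by
  have H : ∀ i, ∃ τ, i ≤ n → (ncS n γ τ ∧ ncCd n τ = i ∧ omegaTilde n τ ∈ C) := by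
    intro i
    by_cases hi : i ≤ n
    · obtain ⟨τ, h⟩ := nc_max_rank hγ hg hC i hi
      exact ⟨τ, fun _ => h⟩
    · exact ⟨1, fun h => absurd h hi⟩
  choose τ hτ using H
  have h0 : τ 0 = 1 := ncCd_eq_zero (hτ 0 (by omega)).1.1 (hτ 0 (by omega)).2.1
  have hn : τ n = γ := by
    have := hτ n le_rfl
    apply nc_F2 hγ hg this.1 (nc_S_top hγ hg) (by rw [hg]; exact bot_le)
    rw [this.2.1, nc_cd_top hg]
  let l := (List.range n).map fun i => (τ i)⁻¹ * τ (i + 1)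
  have hlen : l.length = n := by simp [l]
  have hprod : ∀ i ≤ n, (l.take i).prod = τ i := by
    intro i
    induction i with
    | zero => intro _; simp [h0]
    | succ i ih =>
      intro hi
      rw [List.prod_take_succ _ _ (by omega), ih (by omega)]
      simp [l]
  have hl : l ∈ ncL n γ := by
    refine ⟨hlen, ?_, ?_⟩
    · intro g hg'
      obtain ⟨i, hi, rfl⟩ := List.mem_map.mp hg'
      rw [List.mem_range] at hi
      have a := hτ i (by omega)
      have b := hτ (i + 1) (by omega)
      have e := nc_F1 hγ hg a.1 b.1 (nc_chain_same hγ hg hC.2.1 a.1 b.1 a.2.2 b.2.2 (by omega))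
      have e1 : ncCd n ((τ i)⁻¹ * τ (i + 1)) = 1 := by omega
      obtain ⟨m, hm1, hm2, hm3⟩ := nc_carter 1 (a.1.1.inv.mul b.1.1) e1
      obtain ⟨t, rfl⟩ := List.length_eq_one_iff.mp hm1
      rw [← hm3]
      simpa using hm2
    · have := hprod n le_rfl
      rw [List.take_of_length_le hlen.le] at this
      rw [this, hn]
  refine ⟨l, hl, ?_⟩
  have hmax := nc_Phi_max hγ hg hl
  apply hmax.2.2 C hC.1 hC.2.1
  rintro π ⟨i, hi, rfl⟩
  rw [hprod i hi]
  exact (hτ i hi).2.2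

theorem nc_max_card {n : ℕ} {γ : Equiv.Perm ℤ} (hγ : inB n γ) (hg : ncFx n γ = ⊥) :
    (ncMax n γ).ncard = (ncL n γ).ncard := by
  have : ncMax n γ = ncPhi n '' ncL n γ := by
    ext C
    constructor
    · intro h
      obtain ⟨l, h1, h2⟩ := nc_Phi_surj hγ hg h
      exact ⟨l, h1, h2⟩
    · rintro ⟨l, h, rfl⟩
      exact nc_Phi_max hγ hg h
  rw [this, Set.ncard_image_of_injOn (nc_Phi_inj hγ hg)]

theorem nc_NCB {p q : ℕ} (hγ : inB (p + q) (gammaPQ p q)) (hg : ncFx (p + q) (gammaPQ p q) = ⊥) :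
    NCB p q = ncP (p + q) (gammaPQ p q) := by
  ext π
  unfold NCB ncP SncB ncS leB
  constructor
  · rintro ⟨τ, ⟨h1, h2⟩, h3⟩
    refine ⟨τ, ⟨h1, ?_⟩, h3⟩
    rw [nc_lenB hγ, nc_lenB h1, nc_lenB (h1.inv.mul hγ), nc_cd_top hg] at h2
    exact h2.symm
  · rintro ⟨τ, ⟨h1, h2⟩, h3⟩
    refine ⟨τ, ⟨h1, ?_⟩, h3⟩
    rw [nc_lenB hγ, nc_lenB h1, nc_lenB (h1.inv.mul hγ), nc_cd_top hg]
    exact h2.symm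

end ChainPart


section SumPart

open Classical in
noncomputable def ncRf (n : ℕ) : Finset (Equiv.Perm ℤ) :=
  (((ncXf n) ×ˢ (ncXf n)).filter (fun c => c.1 ≠ c.2)).image (fun c => ncR c.1 c.2)

theorem mem_ncRf {n : ℕ} {t : Equiv.Perm ℤ} : t ∈ ncRf n ↔ t ∈ genB n := by
  classical
  rw [genB_iff]
  simp only [ncRf, Finset.mem_image, Finset.mem_filter, Finset.mem_product, mem_ncXf, Prod.exists]
  constructor
  · rintro ⟨x, y, ⟨⟨h1, h2⟩, h3⟩, rfl⟩; exact ⟨x, y, h1, h2, h3, rfl⟩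
  · rintro ⟨x, y, h1, h2, h3, rfl⟩; exact ⟨x, y, ⟨⟨h1, h2⟩, h3⟩, rfl⟩

open Classical in
noncomputable def ncLs (n : ℕ) : ℕ → Equiv.Perm ℤ → Finset (List (Equiv.Perm ℤ))
  | 0, σ => if σ = 1 then {[]} else ∅
  | k + 1, σ => (ncRf n).biUnion fun t => (ncLs n k (t * σ)).image (fun l => t :: l)

theorem nc_gen_sq {n : ℕ} {t : Equiv.Perm ℤ} (h : t ∈ genB n) : t * t = 1 := by
  obtain ⟨x, y, hx, hy, hxy, rfl⟩ := genB_iff.mp h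
  exact ncR_mul_self hx.1 hy.1 hxy

theorem mem_ncLs {n : ℕ} (k : ℕ) (σ : Equiv.Perm ℤ) (l : List (Equiv.Perm ℤ)) :
    l ∈ ncLs n k σ ↔ l.length = k ∧ (∀ g ∈ l, g ∈ genB n) ∧ l.prod = σ := by
  classical
  induction k generalizing σ l with
  | zero =>
    rw [ncLs]
    split_ifs with h
    · subst h
      rw [Finset.mem_singleton]
      constructor
      · rintro rfl; simp
      · rintro ⟨h, _⟩; exact List.length_eq_zero_iff.mp h
    · constructor
      · intro h'; simp at h'
      · rintro ⟨h1, _, h2⟩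
        rw [List.length_eq_zero_iff.mp h1] at h2
        exact absurd h2.symm h
  | succ k ih =>
    rw [ncLs]
    simp only [Finset.mem_biUnion, Finset.mem_image, mem_ncRf]
    constructor
    · rintro ⟨t, ht, m, hm, rfl⟩
      obtain ⟨h1, h2, h3⟩ := (ih _ _).mp hm
      refine ⟨by simp [h1], ?_, ?_⟩
      · intro g hg
        rcases List.mem_cons.mp hg with rfl | hg
        · exact ht
        · exact h2 g hg
      · rw [List.prod_cons, h3, ← mul_assoc, nc_gen_sq ht, one_mul]
    · rintro ⟨h1, h2, h3⟩
      cases l with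
      | nil => simp at h1
      | cons t m =>
        have ht := h2 t (by simp)
        refine ⟨t, ht, m, (ih _ _).mpr ⟨by simpa using h1, fun g hg => h2 g (by simp [hg]), ?_⟩, rfl⟩
        rw [← h3, List.prod_cons, ← mul_assoc, nc_gen_sq ht, one_mul]

noncomputable def ncf (n k : ℕ) (σ : Equiv.Perm ℤ) : ℕ := (ncLs n k σ).card

theorem ncf_zero (n : ℕ) : ncf n 0 1 = 1 := by simp [ncf, ncLs]

theorem ncf_succ (n k : ℕ) (σ : Equiv.Perm ℤ) : ncf n (k + 1) σ = ∑ t ∈ ncRf n, ncf n k (t * σ) := by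
  classical
  unfold ncf
  rw [ncLs, Finset.card_biUnion]
  · apply Finset.sum_congr rfl
    intro t _
    exact Finset.card_image_of_injective _ (List.cons_injective)
  · intro t _ t' _ hne
    rw [Function.onFun, Finset.disjoint_left]
    intro l hl hl'
    obtain ⟨m, _, rfl⟩ := Finset.mem_image.mp hl
    obtain ⟨m', _, h⟩ := Finset.mem_image.mp hl'
    exact hne (List.cons.inj h).1.symm

theorem ncf_cd {n k : ℕ} {σ : Equiv.Perm ℤ} (h : k < ncCd n σ) : ncf n k σ = 0 := by
  unfold ncf
  rw [Finset.card_eq_zero, Finset.eq_empty_iff_forall_notMem]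
  intro l hl
  obtain ⟨h1, h2, h3⟩ := (mem_ncLs _ _ _).mp hl
  have := ncCd_list l h2
  rw [h3] at this
  omega

/-- weights -/
noncomputable def ncEw (G : Equiv.Perm ℤ → ℚ) (x y : ℤ) : ℚ :=
  if y = x then 0 else if y = -x then 2 * G (ncR x y) else G (ncR x y)

noncomputable def ncSx (n : ℕ) (G : Equiv.Perm ℤ → ℚ) (x : ℤ) : ℚ := ∑ y ∈ ncXf n, ncEw G x y

theorem ncEw_neg (G : Equiv.Perm ℤ → ℚ) {x y : ℤ} (hx : x ≠ 0) (hy : y ≠ 0) : ncEw G (-x) (-y) = ncEw G x y := by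
  unfold ncEw
  by_cases h1 : y = x
  · simp [h1]
  · rw [if_neg (by omega : ¬ -y = -x), if_neg h1, ncR_neg x y hx hy (Ne.symm h1)]
    by_cases h2 : y = -x
    · rw [if_pos (by omega), if_pos h2]
    · rw [if_neg (by omega), if_neg h2]

theorem ncSx_neg {n : ℕ} (G : Equiv.Perm ℤ → ℚ) {x : ℤ} (hx : x ≠ 0) : ncSx n G (-x) = ncSx n G x := by
  unfold ncSx
  symm
  apply Finset.sum_equiv (Equiv.neg ℤ)
  · intro y; simp [mem_ncXf, nc_neg_mem_X]
  · intro y hy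
    rw [Equiv.neg_apply, ncEw_neg G hx (mem_ncXf.mp hy).1]

open Classical in
theorem nc_fiber {n : ℕ} (G : Equiv.Perm ℤ → ℚ) {t : Equiv.Perm ℤ} (ht : t ∈ genB n) :
    ∑ c ∈ (((ncXf n) ×ˢ (ncXf n)).filter (fun c => c.1 ≠ c.2)).filter (fun c => ncR c.1 c.2 = t), ncEw G c.1 c.2
      = 4 * G t := by
  classical
  obtain ⟨a, b, ha, hb, hab, rfl⟩ := genB_iff.mp ht
  have ha0 := ha.1
  have hb0 := hb.1
  have hset : (((ncXf n) ×ˢ (ncXf n)).filter (fun c => c.1 ≠ c.2)).filter (fun c => ncR c.1 c.2 = ncR a b)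
      = {(a, b), (b, a), (-a, -b), (-b, -a)} := by
    ext ⟨x, y⟩
    simp only [Finset.mem_filter, Finset.mem_product, mem_ncXf, Finset.mem_insert, Finset.mem_singleton, Prod.mk.injEq]
    constructor
    · rintro ⟨⟨⟨hx, hy⟩, hxy⟩, he⟩
      have h1 := ncR_left hx.1 hy.1 hxy
      rw [he, ncR_apply ha0 hb0 hab] at h1
      split_ifs at h1 <;> omega
    · rintro (⟨rfl, rfl⟩ | ⟨rfl, rfl⟩ | ⟨rfl, rfl⟩ | ⟨rfl, rfl⟩)
      · exact ⟨⟨⟨ha, hb⟩, hab⟩, rfl⟩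
      · exact ⟨⟨⟨hb, ha⟩, hab.symm⟩, ncR_comm _ _ hb0 ha0 hab.symm⟩
      · exact ⟨⟨⟨nc_neg_mem_X.mpr ha, nc_neg_mem_X.mpr hb⟩, by simpa using hab⟩, ncR_neg _ _ ha0 hb0 hab⟩
      · exact ⟨⟨⟨nc_neg_mem_X.mpr hb, nc_neg_mem_X.mpr ha⟩, by simpa using hab.symm⟩,
          (ncR_neg _ _ hb0 ha0 hab.symm).trans (ncR_comm _ _ hb0 ha0 hab.symm)⟩
  rw [hset]
  have e2 : ncEw G b a = ncEw G a b := by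
    unfold ncEw
    rw [if_neg hab, if_neg hab.symm, ncR_comm b a hb0 ha0 hab.symm]
    by_cases h : b = -a
    · rw [if_pos h, if_pos (by omega)]
    · rw [if_neg h, if_neg (by omega)]
  by_cases h : b = -a
  · have : ({(a, b), (b, a), (-a, -b), (-b, -a)} : Finset (ℤ × ℤ)) = {(a, b), (b, a)} := by
      subst h; simp
      ext; simp; tauto
    rw [this, Finset.sum_pair (by simp; omega)]
    simp only [e2]
    rw [ncEw, if_neg hab.symm, if_pos h]
    ring
  · rw [Finset.sum_insert, Finset.sum_insert, Finset.sum_insert, Finset.sum_singleton]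
    · simp only [ncEw_neg G ha0 hb0, ncEw_neg G hb0 ha0, e2]
      rw [ncEw, if_neg hab.symm, if_neg h]
      ring
    all_goals simp; try omega

theorem nc_refl_sum (n : ℕ) (G : Equiv.Perm ℤ → ℚ) :
    2 * ∑ t ∈ ncRf n, G t = ∑ m ∈ Finset.Icc 1 n, ncSx n G (m : ℤ) := by
  classical
  have h1 : ∑ x ∈ ncXf n, ncSx n G x = 4 * ∑ t ∈ ncRf n, G t := by
    unfold ncSx
    rw [← Finset.sum_product', Finset.mul_sum]
    rw [← Finset.sum_filter_of_ne (p := fun c : ℤ × ℤ => c.1 ≠ c.2)]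
    · rw [← Finset.sum_fiberwise_of_maps_to (t := ncRf n) (g := fun c : ℤ × ℤ => ncR c.1 c.2)]
      · apply Finset.sum_congr rfl
        intro t ht
        exact nc_fiber G (mem_ncRf.mp ht)
      · intro c hc
        exact Finset.mem_image_of_mem _ hc
    · intro c _ hc h
      apply hc
      rw [ncEw, if_pos h.symm]
  rw [nc_sumX] at h1
  have h2 : ∑ m ∈ Finset.Icc 1 n, (ncSx n G (m : ℤ) + ncSx n G (-(m : ℤ))) = 2 * ∑ m ∈ Finset.Icc 1 n, ncSx n G (m : ℤ) := by
    rw [Finset.mul_sum]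
    apply Finset.sum_congr rfl
    intro m hm
    rw [ncSx_neg G (by simp at hm; omega)]; ring
  rw [h2] at h1
  linarith

end SumPart


section DataPart

open Finset

noncomputable def ncA (σ : Equiv.Perm ℤ) (g : ℕ → ℚ) (c : ℤ × ℕ) : ℚ :=
  ∑ i ∈ range c.2, g ((σ ^ i) c.1).natAbs

noncomputable def ncBs (σ : Equiv.Perm ℤ) (g : ℕ → ℚ) (P : Multiset (ℤ × ℕ)) : ℚ := (P.map (ncA σ g)).sum

theorem ncBs_add (σ : Equiv.Perm ℤ) (g : ℕ → ℚ) (P Q : Multiset (ℤ × ℕ)) : ncBs σ g (P + Q) = ncBs σ g P + ncBs σ g Q := by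
  simp [ncBs]

theorem ncBs_cons (σ : Equiv.Perm ℤ) (g : ℕ → ℚ) (c : ℤ × ℕ) (P : Multiset (ℤ × ℕ)) : ncBs σ g (c ::ₘ P) = ncA σ g c + ncBs σ g P := by
  simp [ncBs]

theorem ncBs_zero (σ : Equiv.Perm ℤ) (g : ℕ → ℚ) : ncBs σ g 0 = 0 := by simp [ncBs]

theorem ncBs_single (σ : Equiv.Perm ℤ) (g : ℕ → ℚ) (c : ℤ × ℕ) : ncBs σ g {c} = ncA σ g c := by simp [ncBs]

theorem ncA_nonneg (σ : Equiv.Perm ℤ) {g : ℕ → ℚ} (hg : ∀ m, 0 ≤ g m) (c : ℤ × ℕ) : 0 ≤ ncA σ g c :=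
  Finset.sum_nonneg fun _ _ => hg _

theorem ncA_le_ncBs (σ : Equiv.Perm ℤ) {g : ℕ → ℚ} (hg : ∀ m, 0 ≤ g m) {c : ℤ × ℕ} {P : Multiset (ℤ × ℕ)} (h : c ∈ P) :
    ncA σ g c ≤ ncBs σ g P := by
  apply Multiset.single_le_sum
  · intro x hx
    obtain ⟨d, _, rfl⟩ := Multiset.mem_map.mp hx
    exact ncA_nonneg σ hg d
  · exact Multiset.mem_map_of_mem _ h

theorem ncBs_nonneg (σ : Equiv.Perm ℤ) {g : ℕ → ℚ} (hg : ∀ m, 0 ≤ g m) (P : Multiset (ℤ × ℕ)) :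
    0 ≤ ncBs σ g P := by
  apply Multiset.sum_nonneg
  intro x hx
  obtain ⟨d, _, rfl⟩ := Multiset.mem_map.mp hx
  exact ncA_nonneg σ hg d

structure NCData (n : ℕ) (σ : Equiv.Perm ℤ) (P Q : Multiset (ℤ × ℕ)) : Prop where
  hB : inB n σ
  hP : ∀ c ∈ P, 1 ≤ c.2 ∧ (σ ^ c.2) c.1 = c.1
  hQ : ∀ c ∈ Q, 1 ≤ c.2 ∧ (σ ^ c.2) c.1 = -c.1
  hsum : ∀ g : ℕ → ℚ, ncBs σ g P + ncBs σ g Q = ∑ m ∈ Icc 1 n, g m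

variable {n : ℕ} {σ : Equiv.Perm ℤ} {P Q : Multiset (ℤ × ℕ)}

def ncdel (m : ℕ) (j : ℕ) : ℚ := if j = m then 1 else 0

theorem ncdel_nonneg (m j : ℕ) : 0 ≤ ncdel m j := by unfold ncdel; split_ifs <;> norm_num

theorem ncdel_sum (m : ℕ) : ∑ j ∈ Icc 1 n, ncdel m j = if m ∈ Icc 1 n then 1 else 0 := by
  simp only [ncdel, Finset.sum_ite_eq']

theorem ncdel_sum_le (m : ℕ) : ∑ j ∈ Icc 1 n, ncdel m j ≤ 1 := by
  rw [ncdel_sum]; split_ifs <;> norm_num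

theorem ncA_ge_one {c : ℤ × ℕ} {i : ℕ} (hi : i < c.2) : 1 ≤ ncA σ (ncdel ((σ ^ i) c.1).natAbs) c := by
  have := Finset.single_le_sum (f := fun j => ncdel ((σ ^ i) c.1).natAbs ((σ ^ j) c.1).natAbs)
    (fun j _ => ncdel_nonneg _ _) (Finset.mem_range.mpr hi)
  refine le_trans (le_of_eq ?_) this
  simp [ncdel]

theorem NCData.tot (D : NCData n σ P Q) (g : ℕ → ℚ) : ncBs σ g (P + Q) = ∑ m ∈ Icc 1 n, g m := by
  rw [ncBs_add, D.hsum]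

theorem NCData.memX (D : NCData n σ P Q) {c : ℤ × ℕ} (hc : c ∈ P + Q) : c.1 ∈ signedSet n := by
  have h1 : 1 ≤ c.2 := by
    rcases Multiset.mem_add.mp hc with h | h
    · exact (D.hP c h).1
    · exact (D.hQ c h).1
  have a := ncA_ge_one (σ := σ) (c := c) (i := 0) h1
  have b := ncA_le_ncBs σ (ncdel_nonneg ((σ ^ 0) c.1).natAbs) hc
  rw [D.tot, ncdel_sum] at b
  rw [nc_mem_X]
  by_contra hcon
  rw [if_neg (by simpa using hcon)] at b
  linarith

theorem NCData.one_le (D : NCData n σ P Q) {c : ℤ × ℕ} (hc : c ∈ P + Q) : 1 ≤ c.2 := by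
  rcases Multiset.mem_add.mp hc with h | h
  · exact (D.hP c h).1
  · exact (D.hQ c h).1

theorem NCData.dist (D : NCData n σ P Q) {T₁ T₂ : Multiset (ℤ × ℕ)} (hT : P + Q = T₁ + T₂) {c d : ℤ × ℕ}
    (hc : c ∈ T₁) (hd : d ∈ T₂) {i j : ℕ} (hi : i < c.2) (hj : j < d.2) :
    ((σ ^ i) c.1).natAbs ≠ ((σ ^ j) d.1).natAbs := by
  intro he
  have a := ncA_ge_one (σ := σ) hi
  have a' := ncA_ge_one (σ := σ) hj
  rw [← he] at a'
  have b := ncA_le_ncBs σ (ncdel_nonneg ((σ ^ i) c.1).natAbs) hc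
  have b' := ncA_le_ncBs σ (ncdel_nonneg ((σ ^ i) c.1).natAbs) hd
  have e := D.tot (ncdel ((σ ^ i) c.1).natAbs)
  rw [hT, ncBs_add] at e
  have := ncdel_sum_le (n := n) ((σ ^ i) c.1).natAbs
  linarith

theorem NCData.sdist (D : NCData n σ P Q) {c : ℤ × ℕ}
    (hc : c ∈ P + Q) {i j : ℕ} (hi : i < c.2) (hj : j < c.2) (hij : i ≠ j) :
    ((σ ^ i) c.1).natAbs ≠ ((σ ^ j) c.1).natAbs := by
  intro he
  have a : 2 ≤ ncA σ (ncdel ((σ ^ i) c.1).natAbs) c := by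
    have := Finset.sum_le_sum_of_subset_of_nonneg (s := {i, j}) (t := range c.2)
      (f := fun k => ncdel ((σ ^ i) c.1).natAbs ((σ ^ k) c.1).natAbs) (by
        intro k hk
        simp only [Finset.mem_insert, Finset.mem_singleton] at hk
        rw [Finset.mem_range]; rcases hk with rfl | rfl <;> assumption) (fun _ _ _ => ncdel_nonneg _ _)
    rw [Finset.sum_pair hij] at this
    unfold ncA
    refine le_trans (le_of_eq ?_) this
    simp [ncdel, he]; norm_num
  have b := ncA_le_ncBs σ (ncdel_nonneg ((σ ^ i) c.1).natAbs) hc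
  rw [D.tot] at b
  have := ncdel_sum_le (n := n) ((σ ^ i) c.1).natAbs
  linarith

theorem NCData.cover (D : NCData n σ P Q) {m : ℕ} (hm : m ∈ Icc 1 n) :
    ∃ c ∈ P + Q, ∃ i < c.2, ((σ ^ i) c.1).natAbs = m := by
  by_contra hcon
  push Not at hcon
  have e := D.tot (ncdel m)
  rw [ncdel_sum, if_pos hm] at e
  have : ncBs σ (ncdel m) (P + Q) = 0 := by
    apply Multiset.sum_eq_zero
    intro x hx
    obtain ⟨c, hc, rfl⟩ := Multiset.mem_map.mp hx
    apply Finset.sum_eq_zero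
    intro i hi
    rw [ncdel, if_neg (hcon c hc i (Finset.mem_range.mp hi))]
  linarith

theorem NCData.per (D : NCData n σ P Q) {c : ℤ × ℕ} (hc : c ∈ P + Q) : (σ ^ c.2) c.1 = c.1 ∨ (σ ^ c.2) c.1 = -c.1 := by
  rcases Multiset.mem_add.mp hc with h | h
  · exact Or.inl (D.hP c h).2
  · exact Or.inr (D.hQ c h).2

theorem NCData.red (D : NCData n σ P Q) {c : ℤ × ℕ} (hc : c ∈ P + Q) (i : ℕ) :
    ∃ j < c.2, ((σ ^ j) c.1).natAbs = ((σ ^ i) c.1).natAbs := by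
  induction i using Nat.strong_induction_on with
  | _ i ih =>
    by_cases h : i < c.2
    · exact ⟨i, h, rfl⟩
    · have h1 := D.one_le hc
      obtain ⟨j, hj, e⟩ := ih (i - c.2) (by omega)
      refine ⟨j, hj, e.trans ?_⟩
      have : (σ ^ i) c.1 = (σ ^ (i - c.2)) ((σ ^ c.2) c.1) := by
        rw [← Equiv.Perm.mul_apply, ← pow_add, Nat.sub_add_cancel (by omega)]
      rw [this]
      rcases D.per hc with h | h
      · rw [h]
      · rw [h, (D.hB.pow _).1, Int.natAbs_neg]

theorem nc_pow_eq {x y z : ℤ} (hx : x ≠ 0) (hy : y ≠ 0) (hxy : x ≠ y) {k : ℕ}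
    (h : ∀ j, 1 ≤ j → j < k → ((σ ^ j) z).natAbs ≠ x.natAbs ∧ ((σ ^ j) z).natAbs ≠ y.natAbs)
    (i : ℕ) (hi : i < k) : ((ncR x y * σ) ^ i) z = (σ ^ i) z := by
  induction i with
  | zero => rfl
  | succ i ih =>
    rw [pow_succ', Equiv.Perm.mul_apply, ih (by omega), Equiv.Perm.mul_apply, ← Equiv.Perm.mul_apply σ, ← pow_succ']
    exact ncR_other hx hy hxy (h _ (by omega) hi).1 (h _ (by omega) hi).2

theorem nc_pow_last {x y z : ℤ} (hx : x ≠ 0) (hy : y ≠ 0) (hxy : x ≠ y) {k : ℕ} (hk : 1 ≤ k)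
    (h : ∀ j, 1 ≤ j → j < k → ((σ ^ j) z).natAbs ≠ x.natAbs ∧ ((σ ^ j) z).natAbs ≠ y.natAbs) :
    ((ncR x y * σ) ^ k) z = ncR x y ((σ ^ k) z) := by
  obtain ⟨k, rfl⟩ : ∃ k', k = k' + 1 := ⟨k - 1, by omega⟩
  rw [pow_succ', Equiv.Perm.mul_apply, nc_pow_eq hx hy hxy h k (by omega), Equiv.Perm.mul_apply, ← Equiv.Perm.mul_apply σ, ← pow_succ']

theorem NCData.replace {P₀ P₁ Q₀ Q₁ P' Q' : Multiset (ℤ × ℕ)} (D : NCData n σ (P₁ + P₀) (Q₁ + Q₀)) {x y : ℤ}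
    (hx : x ∈ signedSet n) (hy : y ∈ signedSet n) (hxy : x ≠ y)
    (hx' : ∃ c ∈ P₁ + Q₁, ∃ i < c.2, ((σ ^ i) c.1).natAbs = x.natAbs)
    (hy' : ∃ c ∈ P₁ + Q₁, ∃ i < c.2, ((σ ^ i) c.1).natAbs = y.natAbs)
    (hP' : ∀ c ∈ P', 1 ≤ c.2 ∧ ((ncR x y * σ) ^ c.2) c.1 = c.1)
    (hQ' : ∀ c ∈ Q', 1 ≤ c.2 ∧ ((ncR x y * σ) ^ c.2) c.1 = -c.1)
    (hs : ∀ g, ncBs (ncR x y * σ) g P' + ncBs (ncR x y * σ) g Q' = ncBs σ g P₁ + ncBs σ g Q₁) :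
    NCData n (ncR x y * σ) (P' + P₀) (Q' + Q₀) := by
  have hT : (P₁ + P₀) + (Q₁ + Q₀) = (P₁ + Q₁) + (P₀ + Q₀) := add_add_add_comm _ _ _ _
  have hpow : ∀ c ∈ P₀ + Q₀, ∀ i, ((ncR x y * σ) ^ i) c.1 = (σ ^ i) c.1 := by
    intro c hc i
    apply nc_pow_eq hx.1 hy.1 hxy (k := i + 1) _ _ (by omega)
    intro j _ _
    have hc' : c ∈ (P₁ + P₀) + (Q₁ + Q₀) := by rw [hT]; exact Multiset.mem_add.mpr (Or.inr hc)
    obtain ⟨j', hj', e⟩ := D.red hc' j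
    rw [← e]
    constructor
    · obtain ⟨d, hd, i', hi', e'⟩ := hx'
      rw [← e']
      exact (D.dist hT hd hc hi' hj').symm
    · obtain ⟨d, hd, i', hi', e'⟩ := hy'
      rw [← e']
      exact (D.dist hT hd hc hi' hj').symm
  have hbs : ∀ g, ∀ S ≤ P₀ + Q₀, ncBs (ncR x y * σ) g S = ncBs σ g S := by
    intro g S hS
    unfold ncBs
    congr 1
    apply Multiset.map_congr rfl
    intro c hc
    apply Finset.sum_congr rfl
    intro i _
    rw [hpow c (Multiset.mem_of_le hS hc)]
  refine ⟨(ncR_inB hx hy hxy).mul D.hB, ?_, ?_, ?_⟩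
  · intro c hc
    rcases Multiset.mem_add.mp hc with h | h
    · exact hP' c h
    · rw [hpow c (Multiset.mem_add.mpr (Or.inl h))]
      exact D.hP c (Multiset.mem_add.mpr (Or.inr h))
  · intro c hc
    rcases Multiset.mem_add.mp hc with h | h
    · exact hQ' c h
    · rw [hpow c (Multiset.mem_add.mpr (Or.inr h))]
      exact D.hQ c (Multiset.mem_add.mpr (Or.inr h))
  · intro g
    have e := D.hsum g
    have e2 := hs g
    rw [ncBs_add, ncBs_add] at e ⊢
    rw [hbs g P₀ (Multiset.le_add_right _ _), hbs g Q₀ (Multiset.le_add_left _ _)]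
    linarith

/-! ### Change of head -/

theorem ncA_rot (hσ : inB n σ) (g : ℕ → ℚ) {x : ℤ} {k : ℕ} (h : (σ ^ k) x = x ∨ (σ ^ k) x = -x) (i : ℕ) :
    ncA σ g ((σ ^ i) x, k) = ncA σ g (x, k) := by
  induction i with
  | zero => rfl
  | succ i ih =>
    rw [← ih]
    unfold ncA
    simp only
    have e : ∀ j, (σ ^ j) ((σ ^ (i + 1)) x) = (σ ^ (j + 1)) ((σ ^ i) x) := by
      intro j
      rw [← Equiv.Perm.mul_apply, ← Equiv.Perm.mul_apply, ← pow_add, ← pow_add]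
      congr 2; omega
    simp only [e]
    have h1 := Finset.sum_range_succ (fun j => g ((σ ^ j) ((σ ^ i) x)).natAbs) k
    have h2 := Finset.sum_range_succ' (fun j => g ((σ ^ j) ((σ ^ i) x)).natAbs) k
    have h3 : ((σ ^ k) ((σ ^ i) x)).natAbs = ((σ ^ 0) ((σ ^ i) x)).natAbs := by
      rw [← Equiv.Perm.mul_apply, ← pow_add, add_comm, pow_add, Equiv.Perm.mul_apply, pow_zero, Equiv.Perm.one_apply]
      rcases h with h | h
      · rw [h]
      · rw [h, (hσ.pow i).1, Int.natAbs_neg]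
    rw [h3] at h1
    linarith

theorem ncA_neg (hσ : inB n σ) (g : ℕ → ℚ) (x : ℤ) (k : ℕ) : ncA σ g (-x, k) = ncA σ g (x, k) := by
  unfold ncA
  apply Finset.sum_congr rfl
  intro i _
  rw [(hσ.pow i).1, Int.natAbs_neg]

theorem nc_pow_comm (σ : Equiv.Perm ℤ) (k i : ℕ) (x : ℤ) : (σ ^ k) ((σ ^ i) x) = (σ ^ i) ((σ ^ k) x) := by
  rw [← Equiv.Perm.mul_apply, ← pow_add, add_comm, pow_add, Equiv.Perm.mul_apply]

theorem NCData.headP {x z : ℤ} {k i : ℕ} (D : NCData n σ ((x, k) ::ₘ P) Q) (hz : z = (σ ^ i) x ∨ z = -(σ ^ i) x) :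
    NCData n σ ((z, k) ::ₘ P) Q := by
  have h0 := D.hP (x, k) (by simp)
  refine ⟨D.hB, ?_, D.hQ, ?_⟩
  · intro c hc
    rcases Multiset.mem_cons.mp hc with rfl | hc
    · refine ⟨h0.1, ?_⟩
      simp only at h0 ⊢
      rcases hz with rfl | rfl
      · rw [nc_pow_comm, h0.2]
      · rw [(D.hB.pow k).1, nc_pow_comm, h0.2]
    · exact D.hP c (by simp [hc])
  · intro g
    rw [← D.hsum g, ncBs_cons, ncBs_cons]
    rcases hz with rfl | rfl
    · rw [ncA_rot D.hB g (Or.inl h0.2)]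
    · rw [ncA_neg D.hB, ncA_rot D.hB g (Or.inl h0.2)]

theorem NCData.headQ {x z : ℤ} {k i : ℕ} (D : NCData n σ P ((x, k) ::ₘ Q)) (hz : z = (σ ^ i) x ∨ z = -(σ ^ i) x) :
    NCData n σ P ((z, k) ::ₘ Q) := by
  have h0 := D.hQ (x, k) (by simp)
  refine ⟨D.hB, D.hP, ?_, ?_⟩
  · intro c hc
    rcases Multiset.mem_cons.mp hc with rfl | hc
    · refine ⟨h0.1, ?_⟩
      simp only at h0 ⊢
      rcases hz with rfl | rfl
      · rw [nc_pow_comm, h0.2, (D.hB.pow i).1]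
      · rw [(D.hB.pow k).1, nc_pow_comm, h0.2, (D.hB.pow i).1]
    · exact D.hQ c (by simp [hc])
  · intro g
    rw [← D.hsum g, ncBs_cons, ncBs_cons]
    rcases hz with rfl | rfl
    · rw [ncA_rot D.hB g (Or.inr h0.2)]
    · rw [ncA_neg D.hB, ncA_rot D.hB g (Or.inr h0.2)]

end DataPart


section SplitPart

open Finset

variable {n : ℕ} {σ : Equiv.Perm ℤ} {P Q : Multiset (ℤ × ℕ)}

theorem NCData.sdist' (D : NCData n σ P Q) {x : ℤ} {k : ℕ}
    (hc : (x, k) ∈ P + Q) {i j : ℕ} (hi : i < k) (hj : j < k) (hij : i ≠ j) :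
    ((σ ^ i) x).natAbs ≠ ((σ ^ j) x).natAbs := D.sdist hc hi hj hij

theorem NCData.sdist0 (D : NCData n σ P Q) {x : ℤ} {k : ℕ}
    (hc : (x, k) ∈ P + Q) {i : ℕ} (hi : 1 ≤ i) (hi' : i < k) :
    ((σ ^ i) x).natAbs ≠ x.natAbs := D.sdist' hc (j := 0) hi' (by omega) (by omega)

theorem nc_pow_shift (σ : Equiv.Perm ℤ) (i j : ℕ) (x : ℤ) : (σ ^ i) ((σ ^ j) x) = (σ ^ (j + i)) x := by
  rw [← Equiv.Perm.mul_apply, ← pow_add, add_comm]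

/-- the two halves of a split cycle, when cutting at `z = σ^j x` with `y = z` or `y = -z` -/
theorem nc_half (D : NCData n σ P Q) {x y : ℤ} {k j : ℕ} (hc : (x, k) ∈ P + Q) (hj : 1 ≤ j) (hjk : j < k)
    (hy : y.natAbs = ((σ ^ j) x).natAbs) :
    x ∈ signedSet n ∧ y ∈ signedSet n ∧ x ≠ y ∧
    ((ncR x y * σ) ^ j) x = ncR x y ((σ ^ j) x) ∧
    ((ncR x y * σ) ^ (k - j)) ((σ ^ j) x) = ncR x y ((σ ^ k) x) ∧
    ∀ g, ncA (ncR x y * σ) g (x, j) + ncA (ncR x y * σ) g ((σ ^ j) x, k - j) = ncA σ g (x, k) := by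
  have hx : x ∈ signedSet n := D.memX hc
  have hz : (σ ^ j) x ∈ signedSet n := ((D.hB.pow j).mem_iff x).mpr hx
  have hyX : y ∈ signedSet n := by rw [nc_mem_X] at hz ⊢; rw [hy]; exact hz
  have hxy : x ≠ y := by
    intro h
    have := D.sdist0 hc hj hjk
    rw [← hy, h] at this
    exact this rfl
  have c1 : ∀ i, 1 ≤ i → i < j → ((σ ^ i) x).natAbs ≠ x.natAbs ∧ ((σ ^ i) x).natAbs ≠ y.natAbs := by
    intro i h1 h2
    refine ⟨D.sdist0 hc h1 (by omega), ?_⟩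
    rw [hy]; exact D.sdist' hc (by omega) hjk (by omega)
  have c2 : ∀ i, 1 ≤ i → i < k - j → ((σ ^ i) ((σ ^ j) x)).natAbs ≠ x.natAbs ∧ ((σ ^ i) ((σ ^ j) x)).natAbs ≠ y.natAbs := by
    intro i h1 h2
    rw [nc_pow_shift]
    refine ⟨D.sdist0 hc (by omega) (by omega), ?_⟩
    rw [hy]; exact D.sdist' hc (by omega) hjk (by omega)
  refine ⟨hx, hyX, hxy, ?_, ?_, ?_⟩
  · exact nc_pow_last hx.1 hyX.1 hxy hj c1
  · rw [nc_pow_last hx.1 hyX.1 hxy (by omega) c2, nc_pow_shift, Nat.add_sub_cancel' hjk.le]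
  · intro g
    unfold ncA
    simp only
    obtain ⟨d, rfl⟩ : ∃ d, k = j + d := ⟨k - j, by omega⟩
    rw [Finset.sum_range_add, Nat.add_sub_cancel_left]
    rw [Nat.add_sub_cancel_left] at c2
    congr 1
    · apply Finset.sum_congr rfl
      intro i hi
      rw [nc_pow_eq hx.1 hyX.1 hxy c1 i (Finset.mem_range.mp hi)]
    · apply Finset.sum_congr rfl
      intro i hi
      rw [nc_pow_eq hx.1 hyX.1 hxy c2 i (Finset.mem_range.mp hi), nc_pow_shift]

theorem NCData.splitP {x : ℤ} {k j : ℕ} (D : NCData n σ ((x, k) ::ₘ P) Q) (hj : 1 ≤ j) (hjk : j < k) :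
    NCData n (ncR x ((σ ^ j) x) * σ) ((x, j) ::ₘ ((σ ^ j) x, k - j) ::ₘ P) Q := by
  have h0 := (D.hP (x, k) (by simp)).2
  simp only at h0
  obtain ⟨hx, hy, hxy, e1, e2, e3⟩ := nc_half D (y := (σ ^ j) x) (by simp) hj hjk rfl
  have D' : NCData n σ ({(x, k)} + P) (0 + Q) := by simpa using D
  have := D'.replace (P' := {(x, j), ((σ ^ j) x, k - j)}) (Q' := 0) hx hy hxy
    ⟨(x, k), by simp, 0, by simp only; omega, rfl⟩ ⟨(x, k), by simp, j, hjk, rfl⟩ ?_ (by simp) ?_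
  · simpa using this
  · intro c hc
    simp only [Multiset.insert_eq_cons, Multiset.mem_cons, Multiset.mem_singleton] at hc
    rcases hc with rfl | rfl
    · refine ⟨hj, ?_⟩
      rw [e1, ncR_right hx.1 hy.1 hxy]
    · refine ⟨by simp only; omega, ?_⟩
      simp only
      rw [e2, h0, ncR_left hx.1 hy.1 hxy]
  · intro g
    simp only [Multiset.insert_eq_cons, ncBs_cons, ncBs_single, ncBs_zero, e3]

theorem NCData.splitQ1 {x : ℤ} {k j : ℕ} (D : NCData n σ P ((x, k) ::ₘ Q)) (hj : 1 ≤ j) (hjk : j < k) :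
    NCData n (ncR x ((σ ^ j) x) * σ) ((x, j) ::ₘ P) (((σ ^ j) x, k - j) ::ₘ Q) := by
  have h0 := (D.hQ (x, k) (by simp)).2
  simp only at h0
  obtain ⟨hx, hy, hxy, e1, e2, e3⟩ := nc_half D (y := (σ ^ j) x) (by simp) hj hjk rfl
  have D' : NCData n σ (0 + P) ({(x, k)} + Q) := by simpa using D
  have := D'.replace (P' := {(x, j)}) (Q' := {((σ ^ j) x, k - j)}) hx hy hxy
    ⟨(x, k), by simp, 0, by simp only; omega, rfl⟩ ⟨(x, k), by simp, j, hjk, rfl⟩ ?_ ?_ ?_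
  · simpa using this
  · intro c hc
    rw [Multiset.mem_singleton] at hc
    subst hc
    refine ⟨hj, ?_⟩
    rw [e1, ncR_right hx.1 hy.1 hxy]
  · intro c hc
    rw [Multiset.mem_singleton] at hc
    subst hc
    refine ⟨by simp only; omega, ?_⟩
    simp only
    rw [e2, h0, ncR_odd hx.1 hy.1 hxy, ncR_left hx.1 hy.1 hxy]
  · intro g
    simp only [ncBs_single, ncBs_zero, e3, zero_add]

theorem NCData.splitQ2 {x : ℤ} {k j : ℕ} (D : NCData n σ P ((x, k) ::ₘ Q)) (hj : 1 ≤ j) (hjk : j < k) :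
    NCData n (ncR x (-(σ ^ j) x) * σ) (((σ ^ j) x, k - j) ::ₘ P) ((x, j) ::ₘ Q) := by
  have h0 := (D.hQ (x, k) (by simp)).2
  simp only at h0
  obtain ⟨hx, hy, hxy, e1, e2, e3⟩ := nc_half D (y := -(σ ^ j) x) (by simp) hj hjk (Int.natAbs_neg _)
  have D' : NCData n σ (0 + P) ({(x, k)} + Q) := by simpa using D
  have := D'.replace (Q' := {(x, j)}) (P' := {((σ ^ j) x, k - j)}) hx hy hxy
    ⟨(x, k), by simp, 0, by simp only; omega, rfl⟩ ⟨(x, k), by simp, j, hjk, (Int.natAbs_neg _).symm⟩ ?_ ?_ ?_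
  · simpa using this
  · intro c hc
    rw [Multiset.mem_singleton] at hc
    subst hc
    refine ⟨by simp only; omega, ?_⟩
    simp only
    rw [e2, h0, ncR_odd hx.1 hy.1 hxy, ncR_left hx.1 hy.1 hxy, neg_neg]
  · intro c hc
    rw [Multiset.mem_singleton] at hc
    subst hc
    refine ⟨hj, ?_⟩
    simp only
    have := ncR_right hx.1 hy.1 hxy
    rw [ncR_odd hx.1 hy.1 hxy] at this
    rw [e1]
    omega
  · intro g
    simp only [ncBs_single, ncBs_zero, zero_add]
    rw [← e3]; ring

theorem NCData.splitQ0 {x : ℤ} {k : ℕ} (D : NCData n σ P ((x, k) ::ₘ Q)) :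
    NCData n (ncR x (-x) * σ) ((x, k) ::ₘ P) Q := by
  have hc : (x, k) ∈ P + (x, k) ::ₘ Q := by simp
  have h0 := (D.hQ (x, k) (by simp))
  simp only at h0
  have hx : x ∈ signedSet n := D.memX hc
  have hy := nc_neg_mem_X.mpr hx
  have hxy : x ≠ -x := by have := hx.1; omega
  have c1 : ∀ i, 1 ≤ i → i < k → ((σ ^ i) x).natAbs ≠ x.natAbs ∧ ((σ ^ i) x).natAbs ≠ (-x).natAbs := by
    intro i h1 h2
    rw [Int.natAbs_neg]
    exact ⟨D.sdist0 hc h1 h2, D.sdist0 hc h1 h2⟩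
  have D' : NCData n σ (0 + P) ({(x, k)} + Q) := by simpa using D
  have := D'.replace (P' := {(x, k)}) (Q' := 0) hx hy hxy
    ⟨(x, k), by simp, 0, by simp only; omega, rfl⟩
    ⟨(x, k), by simp, 0, by simp only; omega, (Int.natAbs_neg _).symm⟩ ?_ (by simp) ?_
  · simpa using this
  · intro c hc
    rw [Multiset.mem_singleton] at hc
    subst hc
    refine ⟨h0.1, ?_⟩
    simp only
    rw [nc_pow_last hx.1 hy.1 hxy h0.1 c1, h0.2, ncR_right hx.1 hy.1 hxy]
  · intro g
    simp only [ncBs_single, ncBs_zero, zero_add, add_zero]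
    apply Finset.sum_congr rfl
    intro i hi
    simp only at hi ⊢
    rw [nc_pow_eq hx.1 hy.1 hxy c1 i (Finset.mem_range.mp hi)]

theorem NCData.join {x y : ℤ} {p q : ℕ} (D : NCData n σ P ((x, p) ::ₘ (y, q) ::ₘ Q)) :
    NCData n (ncR x y * σ) ((x, p + q) ::ₘ P) Q := by
  have hcx : (x, p) ∈ P + (x, p) ::ₘ (y, q) ::ₘ Q := by simp
  have hcy : (y, q) ∈ P + (x, p) ::ₘ (y, q) ::ₘ Q := by simp
  have h0 := (D.hQ (x, p) (by simp))
  have h0' := (D.hQ (y, q) (by simp))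
  simp only at h0 h0'
  have hx : x ∈ signedSet n := D.memX hcx
  have hy : y ∈ signedSet n := D.memX hcy
  have hd : ∀ i < p, ∀ j < q, ((σ ^ i) x).natAbs ≠ ((σ ^ j) y).natAbs := by
    intro i hi j hj
    exact D.dist (T₁ := {(x, p)}) (T₂ := P + (y, q) ::ₘ Q) (c := (x, p)) (d := (y, q))
      (by rw [Multiset.add_cons, Multiset.singleton_add]) (by simp) (by simp) hi hj
  have hxy : x ≠ y := by
    intro h
    exact hd 0 (by omega) 0 (by omega) (by simp [h])
  have c1 : ∀ i, 1 ≤ i → i < p → ((σ ^ i) x).natAbs ≠ x.natAbs ∧ ((σ ^ i) x).natAbs ≠ y.natAbs := by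
    intro i h1 h2
    exact ⟨D.sdist0 hcx h1 h2, hd i h2 0 (by omega)⟩
  have c2 : ∀ i, 1 ≤ i → i < q → ((σ ^ i) y).natAbs ≠ x.natAbs ∧ ((σ ^ i) y).natAbs ≠ y.natAbs := by
    intro i h1 h2
    exact ⟨(hd 0 (by omega) i h2).symm, D.sdist0 hcy h1 h2⟩
  have hB' := (ncR_inB hx hy hxy).mul D.hB
  have e1 : ((ncR x y * σ) ^ p) x = -y := by
    rw [nc_pow_last hx.1 hy.1 hxy h0.1 c1, h0.2, ncR_odd hx.1 hy.1 hxy, ncR_left hx.1 hy.1 hxy]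
  have e2 : ((ncR x y * σ) ^ q) y = -x := by
    rw [nc_pow_last hx.1 hy.1 hxy h0'.1 c2, h0'.2, ncR_odd hx.1 hy.1 hxy, ncR_right hx.1 hy.1 hxy]
  have D' : NCData n σ (0 + P) ({(x, p), (y, q)} + Q) := by simpa using D
  have := D'.replace (P' := {(x, p + q)}) (Q' := 0) hx hy hxy
    ⟨(x, p), by simp, 0, by simp only; omega, rfl⟩
    ⟨(y, q), by simp, 0, by simp only; omega, rfl⟩ ?_ (by simp) ?_
  · simpa using this
  · intro c hc
    rw [Multiset.mem_singleton] at hc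
    subst hc
    refine ⟨by simp only; omega, ?_⟩
    simp only
    rw [← nc_pow_shift, e1, (hB'.pow q).1, e2, neg_neg]
  · intro g
    simp only [Multiset.insert_eq_cons, ncBs_cons, ncBs_single, ncBs_zero, zero_add, add_zero]
    unfold ncA
    simp only
    rw [Finset.sum_range_add]
    congr 1
    · apply Finset.sum_congr rfl
      intro i hi
      rw [nc_pow_eq hx.1 hy.1 hxy c1 i (Finset.mem_range.mp hi)]
    · apply Finset.sum_congr rfl
      intro i hi
      rw [← nc_pow_shift, e1, (hB'.pow i).1, nc_pow_eq hx.1 hy.1 hxy c2 i (Finset.mem_range.mp hi), Int.natAbs_neg]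

end SplitPart


section MainPart

open Finset

variable {n : ℕ} {σ : Equiv.Perm ℤ} {P Q : Multiset (ℤ × ℕ)}

theorem nc_pow_fx {v : ncSp n} (hv : v ∈ ncFx n σ) (i : ℕ) (x : ℤ) : ncExt n v ((σ ^ i) x) = ncExt n v x := by
  have := nc_zpow_fx hv (i : ℤ) x
  rwa [zpow_natCast] at this

theorem NCData.fx_zero (D : NCData n σ P Q) {v : ncSp n} (hv : v ∈ ncFx n σ) (h : ∀ c ∈ P, ncExt n v c.1 = 0) : v = 0 := by
  apply ncExt_inj
  intro z
  rw [ncExt_zero]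
  by_cases hz : z ∈ signedSet n
  · rw [nc_mem_X] at hz
    obtain ⟨c, hc, i, hi, e⟩ := D.cover (m := z.natAbs) (Finset.mem_Icc.mpr hz)
    have h0 : ncExt n v c.1 = 0 := by
      rcases Multiset.mem_add.mp hc with hc | hc
      · exact h c hc
      · have h1 := nc_pow_fx hv c.2 c.1
        rw [(D.hQ c hc).2, ncExt_neg] at h1
        linarith
    rw [← nc_pow_fx hv i] at h0
    rcases Int.natAbs_eq_natAbs_iff.mp e with e | e
    · rw [← e, h0]
    · rw [e, ncExt_neg] at h0
      linarith
  · exact ncExt_out v hz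

theorem NCData.finrank_le (D : NCData n σ P Q) : Module.finrank ℝ (ncFx n σ) ≤ Multiset.card P := by
  classical
  let L : ncFx n σ →ₗ[ℝ] (P.toFinset → ℝ) :=
    { toFun := fun v c => ncExt n v.1 c.1.1
      map_add' := by intro v w; ext c; simp [ncExt_add]
      map_smul' := by intro a w; ext c; simp [ncExt_smul] }
  have hL : Function.Injective L := by
    rw [injective_iff_map_eq_zero]
    intro v hv
    apply Subtype.ext
    apply D.fx_zero v.2
    intro c hc
    exact congrFun hv ⟨c, Multiset.mem_toFinset.mpr hc⟩
  have := LinearMap.finrank_le_finrank_of_injective hL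
  rw [Module.finrank_fintype_fun_eq_card, Fintype.card_coe] at this
  exact this.trans (Multiset.toFinset_card_le P)

theorem NCData.zero {x : ℤ} {k : ℕ} (D : NCData n σ ((x, k) ::ₘ P) Q) {y : ℤ} (hy : y ∈ signedSet n)
    (hyx : ∀ i < k, y ≠ (σ ^ i) x) {l : ℕ} (hl : Multiset.card P + 1 + (l + 1) = n) :
    ncf n l (ncR x y * σ) = 0 := by
  classical
  have hc : (x, k) ∈ (x, k) ::ₘ P + Q := by simp
  have hx : x ∈ signedSet n := D.memX hc
  have h0 := D.hP (x, k) (by simp)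
  simp only at h0
  have hxy : x ≠ y := fun h => hyx 0 (by omega) h.symm
  apply ncf_cd
  by_contra hcon
  have hfr := D.finrank_le
  rw [Multiset.card_cons] at hfr
  have hcd := ncCd_add n σ
  have hgen := ncCd_ncR (n := n) hx.1 hy.1 hxy
  have e : ncR x y * (ncR x y * σ) = σ := by rw [← mul_assoc, ncR_mul_self hx.1 hy.1 hxy, one_mul]
  have hle := ncFx_of_le n (ncR x y) (ncR x y * σ) (by rw [e]; omega)
  rw [e] at hle
  let S : Set ℤ := {z | ∃ i < k, z = (σ ^ i) x}
  have hS : S ⊆ signedSet n := by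
    rintro z ⟨i, _, rfl⟩
    exact ((D.hB.pow i).mem_iff x).mpr hx
  have hstep : ∀ z, z ∈ S → σ z ∈ S := by
    rintro z ⟨i, hi, rfl⟩
    by_cases h : i + 1 < k
    · exact ⟨i + 1, h, by rw [pow_succ', Equiv.Perm.mul_apply]⟩
    · refine ⟨0, by omega, ?_⟩
      have : i + 1 = k := by omega
      rw [← Equiv.Perm.mul_apply, ← pow_succ', this, h0.2]; rfl
  have hback : ∀ z, σ z ∈ S → z ∈ S := by
    rintro z ⟨i, hi, h⟩
    by_cases h' : i = 0
    · refine ⟨k - 1, by omega, σ.injective ?_⟩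
      rw [h, ← Equiv.Perm.mul_apply σ, ← pow_succ', Nat.sub_add_cancel h0.1, h0.2, h']; rfl
    · refine ⟨i - 1, by omega, σ.injective ?_⟩
      rw [h, ← Equiv.Perm.mul_apply σ, ← pow_succ', Nat.sub_add_cancel (by omega)]
  have hm : ncInd n S ∈ ncFx n σ := ncInd_mem hS D.hB fun z => ⟨hback z, hstep z⟩
  have hm2 := (ncFx_ncR hx.1 hy.1 hxy _).mp (hle hm).1
  rw [ncExt_ncInd hS, ncExt_ncInd hS] at hm2
  have a1 : x ∈ S := ⟨0, by omega, rfl⟩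
  have a2 : -x ∉ S := by
    rintro ⟨i, hi, h⟩
    by_cases h' : i = 0
    · subst h'
      have := hx.1
      simp at h; omega
    · apply D.sdist0 hc (i := i) (by omega) hi
      rw [← h, Int.natAbs_neg]
  have a3 : y ∉ S := by
    rintro ⟨i, hi, h⟩
    exact hyx i hi h
  rw [if_pos a1, if_neg a2, if_neg a3] at hm2
  split_ifs at hm2 <;> norm_num at hm2

noncomputable def ncG (n l : ℕ) (σ : Equiv.Perm ℤ) (t : Equiv.Perm ℤ) : ℚ := (ncf n l (t * σ) : ℚ)

theorem NCData.zeroE {x : ℤ} {k : ℕ} (D : NCData n σ ((x, k) ::ₘ P) Q) {y : ℤ} (hy : y ∈ signedSet n)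
    (hyx : ∀ i < k, y ≠ (σ ^ i) x) {l : ℕ} (hl : Multiset.card P + 1 + (l + 1) = n) :
    ncEw (ncG n l σ) x y = 0 ∧ ncEw (ncG n l σ) y x = 0 := by
  have h0 := D.hP (x, k) (by simp)
  simp only at h0
  have hx : x ∈ signedSet n := D.memX (c := (x, k)) (by simp)
  have hxy : x ≠ y := fun h => hyx 0 (by omega) h.symm
  have h1 : ncG n l σ (ncR x y) = 0 := by
    rw [ncG, D.zero hy hyx hl]; rfl
  have h2 : ncG n l σ (ncR y x) = 0 := by rw [ncR_comm y x hy.1 hx.1 hxy.symm, h1]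
  unfold ncEw
  rw [h1, h2]
  simp

noncomputable def ncH2 (G : Equiv.Perm ℤ → ℚ) (x : ℤ) (m : ℕ) : ℚ := ncEw G x m + ncEw G x (-(m : ℤ))

theorem ncH2_abs (G : Equiv.Perm ℤ → ℚ) (x z : ℤ) : ncH2 G x z.natAbs = ncEw G x z + ncEw G x (-z) := by
  unfold ncH2
  rcases Int.natAbs_eq z with h | h
  · rw [← h]
  · rw [show ((z.natAbs : ℤ)) = -z by omega, neg_neg, add_comm]

theorem NCData.Sx_eq (D : NCData n σ P Q) (G : Equiv.Perm ℤ → ℚ) (x : ℤ) :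
    ncSx n G x = ncBs σ (ncH2 G x) P + ncBs σ (ncH2 G x) Q := by
  rw [D.hsum, ncSx, nc_sumX]; rfl

theorem ncBs_eq_zero {g : ℕ → ℚ} (h : ∀ c ∈ P, ∀ i < c.2, g ((σ ^ i) c.1).natAbs = 0) : ncBs σ g P = 0 := by
  apply Multiset.sum_eq_zero
  intro x hx
  obtain ⟨c, hc, rfl⟩ := Multiset.mem_map.mp hx
  exact Finset.sum_eq_zero fun i hi => h c hc i (Finset.mem_range.mp hi)

noncomputable def ncWp (P : Multiset (ℤ × ℕ)) : ℚ := (P.map fun c => ncW c.2).prod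

theorem ncWp_cons (c : ℤ × ℕ) (P : Multiset (ℤ × ℕ)) : ncWp (c ::ₘ P) = ncW c.2 * ncWp P := by simp [ncWp]

inductive ncVal : Multiset (ℤ × ℕ) → ℚ → Prop
  | none : ncVal 0 1
  | one (x : ℤ) (k : ℕ) : ncVal {(x, k)} (ncU k)
  | two (x y : ℤ) (p q : ℕ) : ncVal {(x, p), (y, q)} (ncV p q)

def ncIH (n l : ℕ) : Prop := ∀ (σ : Equiv.Perm ℤ) (P Q : Multiset (ℤ × ℕ)) (v : ℚ), NCData n σ P Q → ncVal Q v →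
  Multiset.card P + l = n → (ncf n l σ : ℚ) = (l.factorial : ℚ) * (ncWp P * v)

theorem NCData.paired {x : ℤ} {k : ℕ} (D : NCData n σ ((x, k) ::ₘ P) Q) {v : ℚ} (hv : ncVal Q v) {l : ℕ}
    (hl : Multiset.card P + 1 + (l + 1) = n) (ih : ncIH n l) :
    ncSx n (ncG n l σ) x = (l.factorial : ℚ) * ((∑ j ∈ range (k - 1), ncW (j + 1) * ncW (k - (j + 1))) * (ncWp P * v)) := by
  have hc : (x, k) ∈ (x, k) ::ₘ P + Q := by simp
  have hx : x ∈ signedSet n := D.memX hc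
  have h0 := D.hP (x, k) (by simp)
  simp only at h0
  have hz : ∀ c ∈ P + Q, ∀ i < c.2, ncH2 (ncG n l σ) x ((σ ^ i) c.1).natAbs = 0 := by
    intro c hcc i hi
    have hcX : c.1 ∈ signedSet n := D.memX (by
      rw [Multiset.cons_add]; exact Multiset.mem_cons_of_mem hcc)
    have hzX := ((D.hB.pow i).mem_iff c.1).mpr hcX
    have hd : ∀ j < k, ((σ ^ j) x).natAbs ≠ ((σ ^ i) c.1).natAbs := fun j hj =>
      D.dist (T₁ := {(x, k)}) (T₂ := P + Q) (c := (x, k)) (by rw [Multiset.cons_add, Multiset.singleton_add])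
        (by simp) hcc hj hi
    rw [ncH2_abs, (D.zeroE hzX ?_ hl).1, (D.zeroE (nc_neg_mem_X.mpr hzX) ?_ hl).1, add_zero]
    · intro j hj h; apply hd j hj; rw [← h, Int.natAbs_neg]
    · intro j hj h; apply hd j hj; rw [← h]
  rw [D.Sx_eq, ncBs_cons, ncBs_eq_zero (P := P) fun c hc => hz c (Multiset.mem_add.mpr (Or.inl hc)),
    ncBs_eq_zero (P := Q) fun c hc => hz c (Multiset.mem_add.mpr (Or.inr hc)), add_zero, add_zero]
  unfold ncA
  simp only [ncH2_abs]
  obtain ⟨k, rfl⟩ : ∃ k', k = k' + 1 := ⟨k - 1, by omega⟩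
  have hneg : ∀ i < k + 1, ncEw (ncG n l σ) x (-(σ ^ i) x) = 0 := by
    intro i hi
    refine (D.zeroE (nc_neg_mem_X.mpr (((D.hB.pow i).mem_iff x).mpr hx)) ?_ hl).1
    intro j hj h
    by_cases hij : i = j
    · subst hij
      have := (((D.hB.pow i).mem_iff x).mpr hx).1
      omega
    · apply D.sdist' hc hi hj hij
      rw [← h, Int.natAbs_neg]
  rw [Finset.sum_range_succ', hneg 0 (by omega)]
  have h00 : ncEw (ncG n l σ) x ((σ ^ 0) x) = 0 := by simp [ncEw]
  rw [h00, add_zero, add_zero, Nat.add_sub_cancel, Finset.sum_mul, Finset.mul_sum]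
  apply Finset.sum_congr rfl
  intro i hi
  rw [Finset.mem_range] at hi
  rw [hneg (i + 1) (by omega), add_zero]
  have hne := D.sdist0 hc (i := i + 1) (by omega) (by omega)
  rw [ncEw, if_neg (by intro h; rw [h] at hne; exact hne rfl),
    if_neg (by intro h; rw [h, Int.natAbs_neg] at hne; exact hne rfl), ncG]
  rw [ih _ _ _ _ (D.splitP (j := i + 1) (by omega) (by omega)) hv (by simp only [Multiset.card_cons]; omega), ncWp_cons, ncWp_cons]
  ring

theorem NCData.balP {x : ℤ} {k : ℕ} (D : NCData n σ P ((x, k) ::ₘ Q)) {l : ℕ}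
    (hl : Multiset.card P + (l + 1) = n) : ncBs σ (ncH2 (ncG n l σ) x) P = 0 := by
  have hcx : (x, k) ∈ P + (x, k) ::ₘ Q := by simp
  have hx : x ∈ signedSet n := D.memX hcx
  have h0 := D.hQ (x, k) (by simp)
  simp only at h0
  apply ncBs_eq_zero
  rintro ⟨y, m⟩ hc i hi
  simp only at hi ⊢
  obtain ⟨P', rfl⟩ := Multiset.exists_cons_of_mem hc
  rw [Multiset.card_cons] at hl
  have D1 := D.headP (z := (σ ^ i) y) (Or.inl rfl)
  have D2 := D.headP (z := -(σ ^ i) y) (Or.inr rfl)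
  have key : ∀ z, NCData n σ ((z, m) ::ₘ P') ((x, k) ::ₘ Q) → ncEw (ncG n l σ) x z = 0 := by
    intro z D'
    refine (D'.zeroE hx ?_ hl).2
    intro j hj h
    apply D'.dist (T₁ := {(z, m)}) (T₂ := P' + (x, k) ::ₘ Q) (c := (z, m)) (d := (x, k)) (i := j) (j := 0)
      (by rw [Multiset.cons_add, Multiset.singleton_add]) (by simp) (by simp) hj (by simp only; omega)
    simp [h]
  rw [ncH2_abs, key _ D1, key _ D2, add_zero]

theorem NCData.balOwn {x : ℤ} {k : ℕ} (D : NCData n σ P ((x, k) ::ₘ Q)) {l : ℕ}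
    (hl : Multiset.card P + (l + 1) = n) (ih : ncIH n l) (vf : ℕ → ℚ)
    (hvf : ∀ z j, ncVal ((z, j) ::ₘ Q) (vf j)) (hv0 : ncVal Q (vf 0)) :
    ncA σ (ncH2 (ncG n l σ) x) (x, k) =
      2 * ((l.factorial : ℚ) * (ncWp P * ∑ j ∈ range k, ncW (j + 1) * vf (k - (j + 1)))) := by
  have hc : (x, k) ∈ P + (x, k) ::ₘ Q := by simp
  have hx : x ∈ signedSet n := D.memX hc
  have h0 := D.hQ (x, k) (by simp)
  simp only at h0
  unfold ncA
  simp only [ncH2_abs]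
  obtain ⟨k, rfl⟩ : ∃ k', k = k' + 1 := ⟨k - 1, by omega⟩
  have hx0 := hx.1
  have e0 : ncEw (ncG n l σ) x ((σ ^ 0) x) + ncEw (ncG n l σ) x (-(σ ^ 0) x)
      = 2 * ((l.factorial : ℚ) * (ncWp P * (ncW (k + 1) * vf 0))) := by
    rw [pow_zero, Equiv.Perm.one_apply, ncEw, if_pos rfl, ncEw, if_neg (by omega), if_pos rfl, ncG,
      ih _ _ _ _ D.splitQ0 hv0 (by simp only [Multiset.card_cons]; omega), ncWp_cons]
    ring
  have e1 : ∀ i ∈ range k, ncEw (ncG n l σ) x ((σ ^ (i + 1)) x) + ncEw (ncG n l σ) x (-(σ ^ (i + 1)) x)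
      = (l.factorial : ℚ) * (ncWp P * (ncW (i + 1) * vf (k + 1 - (i + 1)))) +
        (l.factorial : ℚ) * (ncWp P * (ncW (k + 1 - (i + 1)) * vf (i + 1))) := by
    intro i hi
    rw [Finset.mem_range] at hi
    have hne := D.sdist0 hc (i := i + 1) (by omega) (by omega)
    rw [ncEw, if_neg (by omega), if_neg (by omega), ncEw, if_neg (by omega), if_neg (by omega), ncG, ncG,
      ih _ _ _ _ (D.splitQ1 (j := i + 1) (by omega) (by omega)) (hvf _ _) (by simp only [Multiset.card_cons]; omega),
      ih _ _ _ _ (D.splitQ2 (j := i + 1) (by omega) (by omega)) (hvf _ _) (by simp only [Multiset.card_cons]; omega),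
      ncWp_cons, ncWp_cons]
    ring
  rw [Finset.sum_range_succ', e0, Finset.sum_congr rfl e1, Finset.sum_add_distrib, ← Finset.mul_sum, ← Finset.mul_sum,
    ← Finset.mul_sum, ← Finset.mul_sum, Finset.sum_range_succ _ k]
  have hr : ∑ i ∈ range k, ncW (k + 1 - (i + 1)) * vf (i + 1) = ∑ i ∈ range k, ncW (i + 1) * vf (k + 1 - (i + 1)) := by
    rw [← Finset.sum_range_reflect]
    apply Finset.sum_congr rfl
    intro i hi
    rw [Finset.mem_range] at hi
    rw [show k + 1 - (k - 1 - i + 1) = i + 1 by omega, show k - 1 - i + 1 = k + 1 - (i + 1) by omega]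
  rw [hr, Nat.sub_self]
  ring

theorem NCData.bal1 {x : ℤ} {k : ℕ} (D : NCData n σ P {(x, k)}) {l : ℕ}
    (hl : Multiset.card P + (l + 1) = n) (ih : ncIH n l) :
    ncSx n (ncG n l σ) x = 2 * ((l.factorial : ℚ) * (ncWp P * ncU k)) := by
  have D' : NCData n σ P ((x, k) ::ₘ 0) := D
  have h0 := D.hQ (x, k) (by simp)
  simp only at h0
  rw [D'.Sx_eq, D'.balP hl, ncBs_cons, ncBs_zero, zero_add, add_zero,
    D'.balOwn hl ih ncU (fun z j => ncVal.one z j) (by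
      have : ncU 0 = 1 := by simp [ncU]
      rw [this]; exact ncVal.none), nc_N1 k h0.1]

theorem NCData.bal2 {x y : ℤ} {p q : ℕ} (D : NCData n σ P {(x, p), (y, q)}) {l : ℕ}
    (hl : Multiset.card P + (l + 1) = n) (ih : ncIH n l) :
    ncSx n (ncG n l σ) x = 2 * ((l.factorial : ℚ) * (ncWp P *
      (∑ j ∈ range p, ncW (j + 1) * ncV (p - (j + 1)) q + q * ncW (p + q)))) := by
  have D' : NCData n σ P ((x, p) ::ₘ (y, q) ::ₘ 0) := D
  have h0 := D.hQ (x, p) (by simp)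
  simp only at h0
  have hj : ncA σ (ncH2 (ncG n l σ) x) (y, q) = 2 * ((l.factorial : ℚ) * (ncWp P * (q * ncW (p + q)))) := by
    unfold ncA
    simp only [ncH2_abs]
    have key : ∀ z, NCData n σ P ((z, q) ::ₘ (x, p) ::ₘ 0) → z.natAbs ≠ x.natAbs → ncEw (ncG n l σ) x z =
        (l.factorial : ℚ) * (ncWp P * ncW (p + q)) := by
      intro z Dz hne
      rw [Multiset.cons_swap] at Dz
      rw [ncEw, if_neg (by omega), if_neg (by omega), ncG, ih _ _ _ _ Dz.join ncVal.none
        (by simp only [Multiset.card_cons]; omega), ncWp_cons]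
      ring
    have : ∀ i ∈ range q, ncEw (ncG n l σ) x ((σ ^ i) y) + ncEw (ncG n l σ) x (-(σ ^ i) y) =
        2 * ((l.factorial : ℚ) * (ncWp P * ncW (p + q))) := by
      intro i hi
      rw [Finset.mem_range] at hi
      have hd : ((σ ^ i) y).natAbs ≠ x.natAbs :=
        (D'.dist (T₁ := {(x, p)}) (T₂ := P + (y, q) ::ₘ 0) (c := (x, p)) (d := (y, q)) (i := 0) (j := i)
          (by rw [Multiset.add_cons, Multiset.singleton_add]) (by simp) (by simp) (by simp only; omega) hi).symm
      rw [Multiset.cons_swap] at D'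
      rw [key _ (D'.headQ (Or.inl rfl)) hd, key _ (D'.headQ (Or.inr rfl)) (by rwa [Int.natAbs_neg])]
      ring
    rw [Finset.sum_congr rfl this, Finset.sum_const, Finset.card_range, nsmul_eq_mul]
    ring
  rw [D'.Sx_eq, D'.balP hl, ncBs_cons, ncBs_cons, ncBs_zero, zero_add, add_zero, hj,
    D'.balOwn hl ih (fun j => ncV j q) (fun z j => ncVal.two z y j q) (by
      simp only [ncV_zero]; exact ncVal.one y q)]
  ring

theorem ncA_const {g : ℕ → ℚ} {x : ℤ} {k : ℕ} {a : ℚ} (h : ∀ i < k, g ((σ ^ i) x).natAbs = a) : ncA σ g (x, k) = k * a := by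
  unfold ncA
  rw [Finset.sum_congr rfl (fun i hi => h i (Finset.mem_range.mp hi)), Finset.sum_const, Finset.card_range, nsmul_eq_mul]

theorem ncSx_abs (G : Equiv.Perm ℤ → ℚ) {z : ℤ} (hz : z ≠ 0) : ncSx n G (z.natAbs : ℤ) = ncSx n G z := by
  rcases Int.natAbs_eq z with h | h
  · rw [← h]
  · rw [show ((z.natAbs : ℤ)) = -z by omega, ncSx_neg G hz]

theorem NCData.pow_ne (D : NCData n σ P Q) {x : ℤ} {k : ℕ} (hc : (x, k) ∈ P + Q) (i : ℕ) : (σ ^ i) x ≠ 0 :=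
  (((D.hB.pow i).mem_iff x).mpr (D.memX hc)).1

theorem NCData.balTot (D : NCData n σ P Q) {v : ℚ} (hv : ncVal Q v) {l : ℕ}
    (hl : Multiset.card P + (l + 1) = n) (ih : ncIH n l) :
    ncBs σ (fun m => ncSx n (ncG n l σ) (m : ℤ)) Q = 2 * ((l.factorial : ℚ) * (ncWp P * v)) * ncBs σ (fun _ => 1) Q := by
  cases hv with
  | none => simp [ncBs_zero]
  | one x k =>
    rw [ncBs_single, ncBs_single, ncA_const (g := fun _ => (1:ℚ)) (a := 1) (fun _ _ => rfl),
      ncA_const (a := 2 * ((l.factorial : ℚ) * (ncWp P * ncU k)))]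
    · ring
    · intro i hi
      rw [ncSx_abs _ (D.pow_ne (k := k) (by simp) i)]
      have D' : NCData n σ P ((x, k) ::ₘ 0) := D
      exact (D'.headQ (z := (σ ^ i) x) (Or.inl rfl)).bal1 hl ih
  | two x y p q =>
    have hx := (D.hQ (x, p) (by simp)).1
    have hy := (D.hQ (y, q) (by simp)).1
    have D1 : NCData n σ P ((x, p) ::ₘ (y, q) ::ₘ 0) := D
    have D2 : NCData n σ P ((y, q) ::ₘ (x, p) ::ₘ 0) := by rw [Multiset.cons_swap]; exact D
    simp only [Multiset.insert_eq_cons, ncBs_cons, ncBs_single]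
    rw [ncA_const (g := fun _ => (1:ℚ)) (x := x) (a := 1) (fun _ _ => rfl), ncA_const (g := fun _ => (1:ℚ)) (x := y) (a := 1) (fun _ _ => rfl),
      ncA_const (x := x) (a := 2 * ((l.factorial : ℚ) * (ncWp P *
        (∑ j ∈ range p, ncW (j + 1) * ncV (p - (j + 1)) q + q * ncW (p + q))))),
      ncA_const (x := y) (a := 2 * ((l.factorial : ℚ) * (ncWp P *
        (∑ j ∈ range q, ncW (j + 1) * ncV (q - (j + 1)) p + p * ncW (q + p)))))]
    · have := nc_N3 p q hx hy
      rw [add_comm q p]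
      linear_combination 2 * ((l.factorial : ℚ) * ncWp P) * this
    · intro i hi
      rw [ncSx_abs _ (D.pow_ne (k := q) (by simp) i)]
      exact (D2.headQ (z := (σ ^ i) y) (Or.inl rfl)).bal2 hl ih
    · intro i hi
      rw [ncSx_abs _ (D.pow_ne (k := p) (by simp) i)]
      exact (D1.headQ (z := (σ ^ i) x) (Or.inl rfl)).bal2 hl ih

theorem NCData.pairTot (D : NCData n σ P Q) {v : ℚ} (hv : ncVal Q v) {l : ℕ}
    (hl : Multiset.card P + (l + 1) = n) (ih : ncIH n l) {c : ℤ × ℕ} (hc : c ∈ P) :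
    ncA σ (fun m => ncSx n (ncG n l σ) (m : ℤ)) c = 2 * ((l.factorial : ℚ) * (ncWp P * v)) * ((c.2 : ℚ) - 1) := by
  obtain ⟨x, k⟩ := c
  have h1 := (D.hP _ hc).1
  simp only at h1 ⊢
  obtain ⟨P', rfl⟩ := Multiset.exists_cons_of_mem hc
  rw [Multiset.card_cons] at hl
  rw [ncA_const (a := (l.factorial : ℚ) * ((∑ j ∈ range (k - 1), ncW (j + 1) * ncW (k - (j + 1))) * (ncWp P' * v)))]
  · rw [ncWp_cons]
    have := nc_N2 k h1
    linear_combination ((l.factorial : ℚ) * ncWp P' * v) * this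
  · intro i hi
    rw [ncSx_abs _ (D.pow_ne (k := k) (by simp) i)]
    exact (D.headP (z := (σ ^ i) x) (Or.inl rfl)).paired hv hl ih

theorem ncBs_one (P : Multiset (ℤ × ℕ)) : ncBs σ (fun _ => 1) P = (P.map fun c => (c.2 : ℚ)).sum := by
  unfold ncBs
  congr 1
  apply Multiset.map_congr rfl
  intro c _
  simp [ncA]

theorem nc_step {l : ℕ} (ih : ncIH n l) : ncIH n (l + 1) := by
  intro σ P Q v D hv hl
  have h1 := nc_refl_sum n (ncG n l σ)
  rw [← D.hsum (fun m => ncSx n (ncG n l σ) (m : ℤ)), D.balTot hv hl ih] at h1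
  have h2 : ncBs σ (fun m => ncSx n (ncG n l σ) (m : ℤ)) P =
      2 * ((l.factorial : ℚ) * (ncWp P * v)) * (ncBs σ (fun _ => 1) P - Multiset.card P) := by
    rw [ncBs, Multiset.map_congr rfl (fun c hc => D.pairTot hv hl ih hc), Multiset.sum_map_mul_left, ncBs_one]
    congr 1
    rw [Multiset.sum_map_sub]
    simp
  have h3 := D.hsum (fun _ => 1)
  rw [Finset.sum_const, Nat.card_Icc, Nat.add_sub_cancel, nsmul_eq_mul, mul_one] at h3
  have h4 : ((ncf n (l + 1) σ : ℕ) : ℚ) = ∑ t ∈ ncRf n, ncG n l σ t := by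
    rw [ncf_succ, Nat.cast_sum]; rfl
  rw [← h4, h2] at h1
  have h5 : (Multiset.card P : ℚ) + (l + 1) = n := by exact_mod_cast hl
  rw [Nat.factorial_succ]
  push_cast
  have h6 : ncBs σ (fun _ => 1) Q = (n : ℚ) - ncBs σ (fun _ => 1) P := by linarith
  rw [h6, ← h5] at h1
  linear_combination h1 / 2

theorem nc_base : ncIH n 0 := by
  intro σ P Q v D hv hl
  have h3 := D.hsum (fun _ => 1)
  rw [Finset.sum_const, Nat.card_Icc, Nat.add_sub_cancel, nsmul_eq_mul, mul_one] at h3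
  have hQ0 : 0 ≤ ncBs σ (fun _ => 1) Q := ncBs_nonneg σ (fun _ => by norm_num) Q
  have hP : ncBs σ (fun _ => 1) P = (P.map fun c => (c.2 : ℚ) - 1).sum + Multiset.card P := by
    rw [ncBs_one, Multiset.sum_map_sub]; simp
  have hnn : ∀ c ∈ P, 0 ≤ (c.2 : ℚ) - 1 := by
    intro c hc
    have : (1 : ℚ) ≤ c.2 := by exact_mod_cast (D.hP c hc).1
    linarith
  have hS0 : 0 ≤ (P.map fun c => (c.2 : ℚ) - 1).sum := by
    apply Multiset.sum_nonneg
    intro x hx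
    obtain ⟨c, hc, rfl⟩ := Multiset.mem_map.mp hx
    exact hnn c hc
  have hcard : (Multiset.card P : ℚ) = n := by exact_mod_cast hl
  have hsz : ∀ c ∈ P, c.2 = 1 := by
    intro c hc
    have a : (c.2 : ℚ) - 1 ≤ (P.map fun c => (c.2 : ℚ) - 1).sum := by
      apply Multiset.single_le_sum
      · intro x hx
        obtain ⟨c, hc, rfl⟩ := Multiset.mem_map.mp hx
        exact hnn c hc
      · exact Multiset.mem_map_of_mem (fun c : ℤ × ℕ => (c.2 : ℚ) - 1) hc
    have b := hnn c hc
    have : (c.2 : ℚ) = 1 := by linarith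
    exact_mod_cast this
  have hQe : Q = 0 := by
    rw [Multiset.eq_zero_iff_forall_notMem]
    intro c hc
    have a := ncA_le_ncBs σ (g := fun _ => 1) (fun _ => by norm_num) hc
    have b : (1 : ℚ) ≤ c.2 := by exact_mod_cast (D.hQ c hc).1
    have e : ncA σ (fun _ => 1) c = c.2 := by simp [ncA]
    linarith
  subst hQe
  have hv1 : v = 1 := by
    generalize hQ : (0 : Multiset (ℤ × ℕ)) = Q at hv
    cases hv with
    | none => rfl
    | one x k => simp at hQ
    | two x y p q => simp at hQ
  have hσ : σ = 1 := by
    apply Equiv.ext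
    intro z
    rw [Equiv.Perm.one_apply]
    by_cases hz : z ∈ signedSet n
    · rw [nc_mem_X] at hz
      obtain ⟨c, hc, i, hi, e⟩ := D.cover (m := z.natAbs) (Finset.mem_Icc.mpr hz)
      rw [add_zero] at hc
      have h1 := hsz c hc
      have h2 := (D.hP c hc).2
      rw [h1, pow_one] at h2
      have hi0 : i = 0 := by omega
      subst hi0
      rw [pow_zero, Equiv.Perm.one_apply] at e
      rcases Int.natAbs_eq_natAbs_iff.mp e with e | e
      · rw [← e, h2]
      · have : z = -c.1 := by omega
        rw [this, D.hB.1, h2]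
    · exact D.hB.2 z hz
  have hW : ncWp P = 1 := by
    apply Multiset.prod_eq_one
    intro x hx
    obtain ⟨c, hc, rfl⟩ := Multiset.mem_map.mp hx
    rw [hsz c hc]; simp [ncW]
  rw [hσ, ncf_zero, hv1, hW]
  simp

theorem nc_main (l : ℕ) : ncIH n l := by
  induction l with
  | zero => exact nc_base
  | succ l ih => exact nc_step ih

end MainPart


def ncCyc (a p : ℕ) : List ℤ :=
  ((List.range p).map fun i : ℕ => ((a : ℤ) + (i : ℤ) + 1)) ++
      ((List.range p).map fun i : ℕ => -((a : ℤ) + (i : ℤ) + 1))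

theorem ncCyc_nodup (a p : ℕ) : (ncCyc a p).Nodup := by
  unfold ncCyc
  rw [List.nodup_append]
  refine ⟨List.Nodup.map (fun i j h => by simpa using h) List.nodup_range,
    List.Nodup.map (fun i j h => by simpa using h) List.nodup_range, ?_⟩
  intro x hx y hy
  simp only [List.mem_map, List.mem_range] at hx hy
  obtain ⟨i, _, rfl⟩ := hx
  obtain ⟨j, _, rfl⟩ := hy
  omega

theorem ncCyc_mem (a p : ℕ) (x : ℤ) : x ∈ ncCyc a p ↔ (a : ℤ) < |x| ∧ |x| ≤ a + p := by
  unfold ncCyc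
  simp only [List.mem_append, List.mem_map, List.mem_range]
  constructor
  · rintro (⟨i, hi, rfl⟩ | ⟨i, hi, rfl⟩)
    · rw [abs_of_nonneg (by omega)]; omega
    · rw [abs_neg, abs_of_nonneg (by omega)]; omega
  · rintro ⟨h1, h2⟩
    rcases abs_cases x with ⟨h, h0⟩ | ⟨h, h0⟩
    · exact Or.inl ⟨(x - a - 1).toNat, by omega, by omega⟩
    · exact Or.inr ⟨(-x - a - 1).toNat, by omega, by omega⟩

theorem ncCyc_length (a p : ℕ) : (ncCyc a p).length = p + p := by
  simp [ncCyc]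

theorem ncCyc_getl (a p i : ℕ) (hi : i < p) :
    (ncCyc a p)[i]'(by rw [ncCyc_length]; omega) = (a : ℤ) + i + 1 := by
  unfold ncCyc
  rw [List.getElem_append_left (by simpa using hi)]
  simp

theorem ncCyc_getr (a p i : ℕ) (hi : i < p) :
    (ncCyc a p)[p + i]'(by rw [ncCyc_length]; omega) = -((a : ℤ) + i + 1) := by
  unfold ncCyc
  rw [List.getElem_append_right (by simp)]
  simp

theorem ncCyc_step (a p i j : ℕ) (hi : i < p + p) (hj : j = (i + 1) % (p + p)) (hj' : j < p + p) :
    (ncCyc a p).formPerm ((ncCyc a p)[i]'(by rw [ncCyc_length]; omega)) =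
      (ncCyc a p)[j]'(by rw [ncCyc_length]; omega) := by
  rw [List.formPerm_apply_getElem _ (ncCyc_nodup a p)]
  simp only [ncCyc_length, hj]

theorem ncCyc_pos (a p i : ℕ) (hi : i + 1 < p) :
    (ncCyc a p).formPerm ((a : ℤ) + i + 1) = (a : ℤ) + (i + 1 : ℕ) + 1 := by
  rw [← ncCyc_getl a p i (by omega), ← ncCyc_getl a p (i + 1) hi]
  exact ncCyc_step a p i (i + 1) (by omega) (by rw [Nat.mod_eq_of_lt (by omega)]) (by omega)

theorem ncCyc_neg (a p i : ℕ) (hi : i + 1 < p) :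
    (ncCyc a p).formPerm (-((a : ℤ) + i + 1)) = -((a : ℤ) + (i + 1 : ℕ) + 1) := by
  rw [← ncCyc_getr a p i (by omega), ← ncCyc_getr a p (i + 1) hi]
  exact ncCyc_step a p (p + i) (p + (i + 1)) (by omega)
    (by rw [Nat.mod_eq_of_lt (by omega)]; omega) (by omega)

theorem ncCyc_posl (a p : ℕ) :
    (ncCyc a (p + 1)).formPerm ((a : ℤ) + p + 1) = -((a : ℤ) + 1) := by
  have h := ncCyc_step a (p + 1) p (p + 1 + 0) (by omega)
    (by rw [Nat.mod_eq_of_lt (by omega)]) (by omega)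
  rw [ncCyc_getl a (p + 1) p (by omega), ncCyc_getr a (p + 1) 0 (by omega)] at h
  simpa using h

theorem ncCyc_negl (a p : ℕ) :
    (ncCyc a (p + 1)).formPerm (-((a : ℤ) + p + 1)) = (a : ℤ) + 1 := by
  have h := ncCyc_step a (p + 1) (p + 1 + p) 0 (by omega)
    (by rw [show p + 1 + p + 1 = p + 1 + (p + 1) by omega, Nat.mod_self]) (by omega)
  rw [ncCyc_getl a (p + 1) 0 (by omega), ncCyc_getr a (p + 1) p (by omega)] at h
  simpa using h

theorem ncCyc_fix (a p : ℕ) (x : ℤ) (h : ¬ ((a : ℤ) < |x| ∧ |x| ≤ a + p)) :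
    (ncCyc a p).formPerm x = x :=
  List.formPerm_apply_of_notMem (by rwa [ncCyc_mem])

theorem ncCyc_odd_pos (a p : ℕ) (x : ℤ) (hx : 0 ≤ x) :
    (ncCyc a p).formPerm (-x) = -((ncCyc a p).formPerm x) := by
  by_cases h : (a : ℤ) < x ∧ x ≤ a + p
  · obtain ⟨i, hi⟩ : ∃ i : ℕ, x = (a : ℤ) + i + 1 := ⟨(x - a - 1).toNat, by omega⟩
    subst hi
    by_cases h2 : i + 1 < p
    · rw [ncCyc_neg a p i h2, ncCyc_pos a p i h2]
    · obtain rfl : p = i + 1 := by omega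
      rw [ncCyc_negl, ncCyc_posl, neg_neg]
  · rw [ncCyc_fix a p x (by rwa [abs_of_nonneg hx]),
      ncCyc_fix a p (-x) (by rwa [abs_neg, abs_of_nonneg hx])]

theorem ncCyc_odd (a p : ℕ) (x : ℤ) :
    (ncCyc a p).formPerm (-x) = -((ncCyc a p).formPerm x) := by
  rcases le_total 0 x with h | h
  · exact ncCyc_odd_pos a p x h
  · have := ncCyc_odd_pos a p (-x) (by omega)
    rw [neg_neg] at this
    rw [this, neg_neg]

theorem nc_gamma (p q : ℕ) : gammaPQ p q = (ncCyc 0 p).formPerm * (ncCyc p q).formPerm := by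
  have h : (do
      let a ← List.range p
      pure (a : ℤ)) = (List.range p).map (fun i : ℕ => (i : ℤ)) := by
    simp [List.map_eq_flatMap]
  have h' : (do
      let a ← List.range q
      pure (a : ℤ)) = (List.range q).map (fun i : ℕ => (i : ℤ)) := by
    simp [List.map_eq_flatMap]
  unfold gammaPQ ncCyc
  rw [h, h']
  simp only [Nat.cast_zero, zero_add, List.map_map, Function.comp_def]

theorem nc_gamma_inB (p q : ℕ) : inB (p + q) (gammaPQ p q) := by
  rw [nc_gamma]
  constructor
  · intro x
    rw [Equiv.Perm.mul_apply, Equiv.Perm.mul_apply, ncCyc_odd, ncCyc_odd]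
  · intro x hx
    unfold signedSet at hx
    simp only [Set.mem_ofPred_eq, not_and_or, not_not, not_le] at hx
    push_cast at hx
    have hx' : x = 0 ∨ (p : ℤ) + q < |x| := hx
    rw [Equiv.Perm.mul_apply, ncCyc_fix p q x, ncCyc_fix 0 p x]
    · rintro ⟨h1, h2⟩
      rcases hx' with rfl | h
      · simp at h1
      · push_cast at h2; omega
    · rintro ⟨h1, h2⟩
      rcases hx' with rfl | h
      · simp at h1; omega
      · omega

theorem nc_gamma_1 (p q i : ℕ) (hi : i < p) : (gammaPQ p q ^ i) 1 = (i : ℤ) + 1 := by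
  induction i with
  | zero => simp
  | succ i ih =>
    rw [pow_succ', Equiv.Perm.mul_apply, ih (by omega), nc_gamma, Equiv.Perm.mul_apply,
      ncCyc_fix p q _ (by rw [abs_of_nonneg (by omega)]; omega)]
    have := ncCyc_pos 0 p i hi
    simpa using this

theorem nc_gamma_1l (p q : ℕ) (hp : 1 ≤ p) : (gammaPQ p q ^ p) 1 = -1 := by
  obtain ⟨p, rfl⟩ : ∃ k, p = k + 1 := ⟨p - 1, by omega⟩
  rw [pow_succ', Equiv.Perm.mul_apply, nc_gamma_1 _ q p (by omega), nc_gamma, Equiv.Perm.mul_apply,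
      ncCyc_fix (p + 1) q _ (by rw [abs_of_nonneg (by omega)]; push_cast; omega)]
  have := ncCyc_posl 0 p
  simpa using this

theorem nc_gamma_2 (p q i : ℕ) (hi : i < q) : (gammaPQ p q ^ i) ((p : ℤ) + 1) = (p : ℤ) + i + 1 := by
  induction i with
  | zero => simp
  | succ i ih =>
    rw [pow_succ', Equiv.Perm.mul_apply, ih (by omega), nc_gamma, Equiv.Perm.mul_apply,
      ncCyc_pos p q i hi,
      ncCyc_fix 0 p _ (by rw [abs_of_nonneg (by omega)]; push_cast; omega)]

theorem nc_gamma_2l (p q : ℕ) (hq : 1 ≤ q) : (gammaPQ p q ^ q) ((p : ℤ) + 1) = -((p : ℤ) + 1) := by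
  obtain ⟨q, rfl⟩ : ∃ k, q = k + 1 := ⟨q - 1, by omega⟩
  rw [pow_succ', Equiv.Perm.mul_apply, nc_gamma_2 p _ q (by omega), nc_gamma, Equiv.Perm.mul_apply,
    ncCyc_posl, ncCyc_fix 0 p _ (by rw [abs_neg, abs_of_nonneg (by omega)]; push_cast; omega)]

theorem nc_gamma_data (p q : ℕ) (hp : 1 ≤ p) (hq : 1 ≤ q) :
    NCData (p + q) (gammaPQ p q) 0 {((1 : ℤ), p), ((p : ℤ) + 1, q)} where
  hB := nc_gamma_inB p q
  hP := by simp
  hQ := by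
    intro c hc
    simp only [Multiset.insert_eq_cons, Multiset.mem_cons, Multiset.mem_singleton] at hc
    rcases hc with rfl | rfl
    · exact ⟨hp, nc_gamma_1l p q hp⟩
    · exact ⟨hq, nc_gamma_2l p q hq⟩
  hsum := by
    intro g
    rw [Multiset.insert_eq_cons, ncBs_zero, ncBs_cons, ncBs_single, zero_add]
    unfold ncA
    have e1 : ∀ i ∈ Finset.range p, g (((gammaPQ p q) ^ i) 1).natAbs = g (i + 1) := by
      intro i hi
      rw [nc_gamma_1 p q i (Finset.mem_range.mp hi)]
      congr 1
    have e2 : ∀ i ∈ Finset.range q, g (((gammaPQ p q) ^ i) ((p : ℤ) + 1)).natAbs = g (p + i + 1) := by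
      intro i hi
      rw [nc_gamma_2 p q i (Finset.mem_range.mp hi)]
      congr 1
    simp only
    rw [Finset.sum_congr rfl e1, Finset.sum_congr rfl e2,
      ← Finset.sum_range_add (fun i => g (i + 1)) p q, Finset.range_eq_Ico, Finset.sum_Ico_add' g 0 (p + q) 1]
    rfl


theorem ncb_maximal_chains_card (p q : ℕ) (hp : 1 ≤ p) (hq : 1 ≤ q) :
    {C : Set (Set (Set ℤ)) | C ⊆ NCB p q ∧ IsChain refines C ∧
        ∀ D : Set (Set (Set ℤ)), D ⊆ NCB p q → IsChain refines D → C ⊆ D → C = D}.ncard =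
      Nat.choose (p + q) p * p ^ p * q ^ q +
        ∑ c ∈ Finset.Icc 1 p,
          2 * c * Nat.choose (p + q) (p - c) * p ^ (p - c) * q ^ (q + c) := by
  have D := nc_gamma_data p q hp hq
  have hg : ncFx (p + q) (gammaPQ p q) = ⊥ := by
    rw [eq_bot_iff]
    intro v hv
    exact (Submodule.mem_bot _).mpr (D.fx_zero hv (by simp))
  have h1 := nc_max_card D.hB hg
  rw [nc_NCB D.hB hg]
  change (ncMax (p + q) (gammaPQ p q)).ncard = _
  rw [h1]
  have h2 : ncL (p + q) (gammaPQ p q) = ↑(ncLs (p + q) (p + q) (gammaPQ p q)) := by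
    ext l
    rw [Finset.mem_coe, mem_ncLs]
    rfl
  rw [h2, Set.ncard_coe_finset]
  have h3 := nc_main (n := p + q) (p + q) _ _ _ _ D (ncVal.two _ _ p q) (by simp)
  have h4 := nc_final p q
  have h5 : ncWp 0 = 1 := by simp [ncWp]
  rw [h5, one_mul, h4] at h3
  exact_mod_cast h3
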